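/- arXiv:2206.11933 — 4 statements merged into one kernel-verified Lean document; each statement's English description precedes it below -/
import Mathlib

section
/- Let α ∈ (0,1) be irrational, let T : [0,1] → [0,1] be the rotation T(x) = x + α for x ∈ [0, 1−α) and T(x) = x + α − 1 for x ∈ [1−α, 1], and set p_k = T^k(0) for k ≥ 0. Let b > 1 and ε_k = (1 − 1/b)·b^{−(k−1)} for k ≥ 1. Then for all integers k, j ≥ 1 one has p_k < p_j if and only if ε_k + Σ_{ℓ ≥ 1, p_ℓ < p_k} ε_ℓ < Σ_{ℓ ≥ 1, p_ℓ < p_j} ε_ℓ. -/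
open Filter Topology

noncomputable def phiGolden : ℝ := (1 + Real.sqrt 5) / 2

noncomputable def fibWord (k : ℕ) : ℤ :=
  2 + ⌊((k : ℝ) + 1) * phiGolden⌋ - ⌊((k : ℝ) + 2) * phiGolden⌋

noncomputable def fibDelta (b : ℝ) : ℝ :=
  1 - 1 / b + (1 / b) * (1 - 1 / b) * ∑' k : ℕ, (fibWord k : ℝ) * (1 / b) ^ k

noncomputable def rhoParam (b : ℝ) : ℝ :=
  500 * b / (b - 1) * (b * (1 - fibDelta b) + 1)

noncomputable def pwc (r v₁ v₂ ρ : ℝ) (x : ℝ) : ℝ :=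
  if x < ρ then (1 + r) * x + v₁ else (1 + r) * x + v₂

def omegaLim (g : ℝ → ℝ) (x : ℝ) : Set ℝ :=
  {p : ℝ | ∃ n : ℕ → ℕ, StrictMono n ∧ Tendsto (fun k => g^[n k] x) atTop (𝓝 p)}

def IsCantorSet (C : Set ℝ) : Prop :=
  C.Nonempty ∧ IsCompact C ∧ Perfect C ∧ IsNowhereDense C

def IsPeriodicSeq (a : ℕ → ℝ) : Prop := ∃ n ≥ 1, ∀ i, a (i + n) = a i

def AsymptoticTo (s a : ℕ → ℝ) : Prop :=
  Tendsto (fun n => |s n - a n|) atTop (𝓝 0)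

open scoped Classical in
noncomputable def visitCount (g : ℝ → ℝ) (x : ℝ) (J : Set ℝ) (N : ℕ) : ℕ :=
  ((Finset.range N).filter (fun n => g^[n] x ∈ J)).card

noncomputable def alphaRot : ℝ := (3 - Real.sqrt 5) / 2

noncomputable def Trot (x : ℝ) : ℝ :=
  if x < 1 - alphaRot then x + alphaRot else x + alphaRot - 1

noncomputable def gmap (b : ℝ) (x : ℝ) : ℝ :=
  if x < b * (1 - fibDelta b) then x / b + fibDelta b else x / b + fibDelta b - 1

noncomputable def fmap (b : ℝ) (x : ℝ) : ℝ :=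
  if x < rhoParam b then x / b + 1000 else x / b + 500

noncomputable def Kset (b : ℝ) : Set ℝ :=
  Set.Icc (500 * b / (b - 1) * (2 - fibDelta b))
    (500 * b / (b - 1) * (3 - fibDelta b - 1 / b))

noncomputable def TrotGen (α : ℝ) (x : ℝ) : ℝ :=
  if x < 1 - α then x + α else x + α - 1

lemma trot_iter (α : ℝ) (hα0 : 0 < α) (hα1 : α < 1) (n : ℕ) :
    (TrotGen α)^[n] 0 = Int.fract (n * α) := by
  induction n with
  | zero => simp
  | succ n ih =>
    rw [Function.iterate_succ_apply', ih, eq_comm, Int.fract_eq_iff]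
    have h0 := Int.fract_nonneg (n * α)
    have h1 := Int.fract_lt_one (n * α)
    have h2 := Int.floor_add_fract (n * α)
    unfold TrotGen
    split_ifs with h
    · refine ⟨by linarith, by linarith, ⌊n * α⌋, ?_⟩
      push_cast
      linarith
    · refine ⟨by linarith, by linarith, ⌊n * α⌋ + 1, ?_⟩
      push_cast
      linarith

lemma exists_fract (α : ℝ) (hirr : Irrational α) (x y : ℝ) (hx : 0 ≤ x) (hxy : x < y)
    (hy : y < 1) : ∃ n : ℕ, 1 ≤ n ∧ x < Int.fract (n * α) ∧ Int.fract (n * α) < y := by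
  haveI : Fact ((0 : ℝ) < 1) := ⟨one_pos⟩
  have hd : DenseRange (· • (α : AddCircle (1 : ℝ)) : ℕ → AddCircle (1 : ℝ)) := by
    rw [← denseRange_zsmul_iff_nsmul, AddCircle.denseRange_zsmul_coe_iff]
    simpa using hirr
  have ho : IsOpen ((fun t : ℝ => (t : AddCircle (1 : ℝ))) '' Set.Ioo x y) :=
    QuotientAddGroup.isOpenMap_coe _ isOpen_Ioo
  obtain ⟨n, z, ⟨hz1, hz2⟩, hz⟩ := hd.exists_mem_open ho ((Set.nonempty_Ioo.2 hxy).image _)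
  have hz' : ((z : ℝ) : AddCircle (1 : ℝ)) = ((n * α : ℝ) : AddCircle (1 : ℝ)) := by
    simpa [← nsmul_eq_mul] using hz
  have h3 := (QuotientAddGroup.eq_iff_sub_mem).1 hz'
  obtain ⟨m, hm⟩ := AddSubgroup.mem_zmultiples_iff.1 h3
  have hm' : (m : ℝ) = z - n * α := by simpa using hm
  have hf : Int.fract (n * α) = z := by
    rw [Int.fract_eq_iff]
    refine ⟨by linarith, by linarith, -m, ?_⟩
    push_cast
    linarith
  refine ⟨n, ?_, by rw [hf]; exact hz1, by rw [hf]; exact hz2⟩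
  rcases Nat.eq_zero_or_pos n with h | h
  · subst h
    simp at hf
    linarith
  · exact h

lemma stmt_aux (p : ℕ → ℝ) (e : ℕ → ℝ) (hpos : ∀ l, 0 < e l) (hsum : Summable e)
    (k j : ℕ) (hk : 1 ≤ k) (hex : p k < p j → ∃ n, 1 ≤ n ∧ p k < p n ∧ p n < p j) :
    p k < p j ↔ e k + (∑' l : ℕ, Set.indicator {l : ℕ | 1 ≤ l ∧ p l < p k} e l) <
      ∑' l : ℕ, Set.indicator {l : ℕ | 1 ≤ l ∧ p l < p j} e l := by
  constructor
  · intro h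
    obtain ⟨n, hn, h1, h2⟩ := hex h
    have hs : e k + (∑' l : ℕ, Set.indicator {l : ℕ | 1 ≤ l ∧ p l < p k} e l) =
        ∑' l : ℕ, Set.indicator {l : ℕ | l = k ∨ 1 ≤ l ∧ p l < p k} e l := by
      rw [← tsum_ite_eq k (fun _ => e k), ← Summable.tsum_add]
      · congr 1
        ext l
        by_cases hl : l = k
        · subst hl; simp
        · simp [Set.indicator, hl]
      · exact (hasSum_ite_eq k (e k)).summable
      · exact hsum.indicator _
    rw [hs]
    refine Summable.tsum_lt_tsum (i := n) ?_ ?_ (hsum.indicator _) (hsum.indicator _)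
    · intro l
      refine Set.indicator_le_indicator_of_subset ?_ (fun l => (hpos l).le) l
      rintro l (rfl | ⟨hl, hl'⟩)
      · exact ⟨hk, h⟩
      · exact ⟨hl, hl'.trans h⟩
    · rw [Set.indicator_of_notMem, Set.indicator_of_mem]
      · exact hpos n
      · exact ⟨hn, h2⟩
      · rintro (rfl | ⟨_, h3⟩)
        · exact lt_irrefl _ h1
        · exact lt_asymm h1 h3
  · intro h
    by_contra! hc
    have : ∑' l : ℕ, Set.indicator {l : ℕ | 1 ≤ l ∧ p l < p j} e l ≤
        ∑' l : ℕ, Set.indicator {l : ℕ | 1 ≤ l ∧ p l < p k} e l := by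
      refine Summable.tsum_le_tsum ?_ (hsum.indicator _) (hsum.indicator _)
      intro l
      refine Set.indicator_le_indicator_of_subset ?_ (fun l => (hpos l).le) l
      rintro l ⟨hl, hl'⟩
      exact ⟨hl, hl'.trans_le hc⟩
    have := hpos k
    linarith

theorem stmt14 (α b : ℝ) (hα0 : 0 < α) (hα1 : α < 1) (hirr : Irrational α)
    (hb : 1 < b) (k j : ℕ) (hk : 1 ≤ k) (hj : 1 ≤ j) :
    (TrotGen α)^[k] 0 < (TrotGen α)^[j] 0 ↔
      (1 - 1 / b) * (1 / b) ^ (k - 1) +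
        (∑' ℓ : ℕ, Set.indicator
          {ℓ : ℕ | 1 ≤ ℓ ∧ (TrotGen α)^[ℓ] 0 < (TrotGen α)^[k] 0}
          (fun ℓ => (1 - 1 / b) * (1 / b) ^ (ℓ - 1)) ℓ) <
      ∑' ℓ : ℕ, Set.indicator
          {ℓ : ℕ | 1 ≤ ℓ ∧ (TrotGen α)^[ℓ] 0 < (TrotGen α)^[j] 0}
          (fun ℓ => (1 - 1 / b) * (1 / b) ^ (ℓ - 1)) ℓ := by
  have hfr := trot_iter α hα0 hα1
  have hb0 : 0 < 1 / b := by positivity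
  have hb1 : 1 / b < 1 := by rw [div_lt_one] <;> linarith
  refine stmt_aux (fun n => (TrotGen α)^[n] 0) (fun ℓ : ℕ => (1 - 1 / b) * (1 / b) ^ (ℓ - 1))
    (fun ℓ => mul_pos (by linarith) (by positivity)) ?_ k j hk ?_
  · apply Summable.mul_left
    rw [← summable_nat_add_iff 1]
    simpa using summable_geometric_of_lt_one hb0.le hb1
  · simp only [hfr]
    intro h
    exact exists_fract α hirr _ _ (Int.fract_nonneg _) h (Int.fract_lt_one _)
end

section
/- Let b > 1, let δ be defined from the Fibonacci word, let ρ = (500b/(b−1))·(b(1−δ)+1), let f : ℝ → ℝ be defined by f(x) = x/b + 1000 if x < ρ and f(x) = x/b + 500 if x ≥ ρ, and let C be the Cantor set with ω_f(x) = C for all x ∈ ℝ. Then for every S₀ ∈ C and every ε > 0, there exists an integer k ≥ 0 such that ρ belongs to the image f^k((S₀ − ε, S₀ + ε)); that is, every open interval around a point of C eventually covers the discontinuity ρ under iteration of f. -/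
open Filter Topology

theorem stmt15 (b : ℝ) (hb : 1 < b) (C : Set ℝ) (hC : IsCantorSet C)
    (hω : ∀ x : ℝ, omegaLim (fmap b) x = C) :
    ∀ S₀ ∈ C, ∀ ε > 0, ∃ k : ℕ,
      rhoParam b ∈ (fmap b)^[k] '' Set.Ioo (S₀ - ε) (S₀ + ε) := by
  intro S₀ hS ε hε
  by_contra hno
  push Not at hno
  have hno' : ∀ k : ℕ, ∀ y, S₀ - ε < y → y < S₀ + ε → (fmap b)^[k] y ≠ rhoParam b := by
    intro k y h1 h2 h3
    exact hno k ⟨y, ⟨h1, h2⟩, h3⟩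
  have hb0 : (0:ℝ) < b := by linarith
  have aff : ∀ k : ℕ, ∀ x, S₀ - ε < x → x < S₀ + ε →
      (fmap b)^[k] x = (fmap b)^[k] S₀ + (x - S₀) / b ^ k := by
    intro k
    induction k with
    | zero => intro x _ _; simp
    | succ k ih =>
      intro x h1 h2
      rw [Function.iterate_succ_apply', Function.iterate_succ_apply']
      have hbk : (0:ℝ) < b ^ k := by positivity
      have ihx := ih x h1 h2
      have key : S₀ - ε < S₀ + b ^ k * (rhoParam b - (fmap b)^[k] S₀) →
          S₀ + b ^ k * (rhoParam b - (fmap b)^[k] S₀) < S₀ + ε → False := by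
        intro h3 h4
        apply hno' k _ h3 h4
        rw [ih _ h3 h4]
        field_simp
        ring
      have hx : x - S₀ = b ^ k * ((fmap b)^[k] x - (fmap b)^[k] S₀) := by
        rw [ihx]; field_simp; ring
      have hside : (fmap b)^[k] x < rhoParam b ↔ (fmap b)^[k] S₀ < rhoParam b := by
        constructor
        · intro h
          by_contra h'
          push Not at h'
          have a1 : b ^ k * ((fmap b)^[k] x - (fmap b)^[k] S₀) ≤
              b ^ k * (rhoParam b - (fmap b)^[k] S₀) := by gcongr
          have a2 : b ^ k * (rhoParam b - (fmap b)^[k] S₀) ≤ 0 :=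
            mul_nonpos_of_nonneg_of_nonpos hbk.le (by linarith)
          exact key (by linarith) (by linarith)
        · intro h
          by_contra h'
          push Not at h'
          have a1 : b ^ k * (rhoParam b - (fmap b)^[k] S₀) ≤
              b ^ k * ((fmap b)^[k] x - (fmap b)^[k] S₀) := by gcongr
          have a2 : 0 ≤ b ^ k * (rhoParam b - (fmap b)^[k] S₀) :=
            mul_nonneg hbk.le (by linarith)
          exact key (by linarith) (by linarith)
      have e : (x - S₀) / b ^ (k+1) = ((fmap b)^[k] x - (fmap b)^[k] S₀) / b := by
        rw [hx, pow_succ]; field_simp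
      rw [e]
      unfold fmap at hside ⊢
      simp only [hside]
      split_ifs <;> ring
  obtain ⟨n, hn, hlim⟩ : S₀ ∈ omegaLim (fmap b) S₀ := by rw [hω]; exact hS
  have e1 : ∀ᶠ k in atTop, |(fmap b)^[n k] S₀ - S₀| < ε / 2 := by
    have := hlim.eventually (Metric.ball_mem_nhds S₀ (half_pos hε))
    simpa [Real.dist_eq] using this
  have e2 : ∀ᶠ k in atTop, 2 < b ^ n k :=
    ((tendsto_pow_atTop_atTop_of_one_lt hb).comp hn.tendsto_atTop).eventually_gt_atTop 2
  obtain ⟨j, h1, h2⟩ := (e1.and e2).exists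
  generalize n j = m at h1 h2
  have hm : 0 < m := by
    rcases Nat.eq_zero_or_pos m with h | h
    · subst h; norm_num at h2
    · exact h
  obtain ⟨d, hd⟩ : ∃ d, d = (fmap b)^[m] S₀ - S₀ := ⟨_, rfl⟩
  rw [← hd] at h1
  obtain ⟨t, ht⟩ : ∃ t, t = b ^ m / (b ^ m - 1) * d := ⟨_, rfl⟩
  have hB : 0 < b ^ m - 1 := by linarith
  have hlt : |t| < ε := by
    rw [ht, abs_mul, abs_of_pos (by positivity)]
    have : b ^ m / (b ^ m - 1) ≤ 2 := by rw [div_le_iff₀ hB]; linarith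
    nlinarith [abs_nonneg d]
  rw [abs_lt] at hlt
  have hp : (fmap b)^[m] (S₀ + t) = S₀ + t := by
    rw [aff m _ (by linarith) (by linarith)]
    have : (fmap b)^[m] S₀ = S₀ + d := by rw [hd]; ring
    rw [this, ht]
    have := hB.ne'
    field_simp
    ring
  have hfin : ((fun i => (fmap b)^[i] (S₀ + t)) '' Set.Iio m).Finite :=
    (Set.finite_Iio m).image _
  have hsub : C ⊆ (fun i => (fmap b)^[i] (S₀ + t)) '' Set.Iio m := by
    rw [← hω (S₀ + t)]
    rintro q ⟨l, -, hl⟩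
    refine hfin.isClosed.mem_of_tendsto hl (Eventually.of_forall fun k => ?_)
    refine ⟨l k % m, Nat.mod_lt _ hm, ?_⟩
    exact Function.IsPeriodicPt.iterate_mod_apply (f := fmap b) hp (l k)
  have hCf : C.Finite := hfin.subset hsub
  have hacc := hC.2.2.1.acc S₀ hS
  rw [accPt_iff_clusterPt] at hacc
  have hcl : IsClosed (C \ {S₀}) := (hCf.subset Set.diff_subset).isClosed
  have : S₀ ∈ C \ {S₀} := by
    rw [← hcl.closure_eq, mem_closure_iff_clusterPt]
    convert hacc using 1
    rw [Filter.inf_principal, Set.diff_eq, Set.inter_comm]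
  exact this.2 rfl
end

section
/- Let b > 1, let δ be defined from the Fibonacci word, let ρ = (500b/(b−1))·(b(1−δ)+1), let f : ℝ → ℝ be defined by f(x) = x/b + 1000 if x < ρ and f(x) = x/b + 500 if x ≥ ρ, let K = [500b(2−δ)/(b−1), 500b(3−δ−1/b)/(b−1)], and let h : K → [0,1] be a topological semiconjugacy from f|_K to the rotation T by α = (3−√5)/2 (i.e., h continuous, nondecreasing, surjective with h ∘ f|_K = T ∘ h). Then for every interval J ⊆ K and every S₀ ≥ 0, the frequency lim_{N→∞} (1/N)·#{0 ≤ n ≤ N−1 : fⁿ(S₀) ∈ J} exists and equals the length of the interval h(J). -/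
open Filter Topology

open MeasureTheory in
lemma weyl_aux (θ x : UnitAddCircle) (hθ : ∀ k : ℤ, k ≠ 0 → fourier k θ ≠ 1)
    (f : C(UnitAddCircle, ℂ)) :
    Tendsto (fun N : ℕ => ((N + 1 : ℝ) : ℂ)⁻¹ * ∑ n ∈ Finset.range (N + 1), f (x + n • θ)) atTop
      (𝓝 (∫ t, f t)) := by
  have hcl : f ∈ (Submodule.span ℂ (Set.range (@fourier 1))).topologicalClosure := by
    rw [span_fourier_closure_eq_top]; trivial
  have hint : ∀ g : C(UnitAddCircle, ℂ), Integrable (fun t => g t) := fun g =>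
    g.continuous.integrable_of_hasCompactSupport (HasCompactSupport.of_compactSpace _)
  have hspan : ∀ g ∈ Submodule.span ℂ (Set.range (@fourier 1)),
      Tendsto (fun N : ℕ => ((N + 1 : ℝ) : ℂ)⁻¹ * ∑ n ∈ Finset.range (N + 1), g (x + n • θ)) atTop
      (𝓝 (∫ t, g t)) := by
    intro g hg
    induction hg using Submodule.span_induction with
    | mem g hg =>
      obtain ⟨k, rfl⟩ := hg
      by_cases hk : k = 0
      · subst hk
        have : ∀ N : ℕ, ((N + 1 : ℝ) : ℂ)⁻¹ * ∑ n ∈ Finset.range (N + 1), 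
            (fourier (T := 1) 0) (x + n • θ) = 1 := by
          intro N
          have : ((N : ℂ) + 1) ≠ 0 := by exact_mod_cast Nat.succ_ne_zero N
          simp [this]
        simp_rw [this]
        simp [measureReal_def]
      · have h0 : ∫ t : UnitAddCircle, fourier k t = 0 := by
          set I := ∫ t : UnitAddCircle, fourier k t with hI
          have h1 : ∫ t : UnitAddCircle, fourier k (t + θ) = I :=
            integral_add_right_eq_self (fun t : UnitAddCircle => fourier k t) θ
          have h2 : ∀ t : UnitAddCircle, fourier k (t + θ) = fourier k t * fourier k θ := by
            intro t; simp [fourier_apply, smul_add, AddCircle.toCircle_add]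
          simp_rw [h2] at h1
          rw [integral_mul_const] at h1
          have h3 : I * (fourier k θ - 1) = 0 := by rw [mul_sub, h1]; ring
          rcases mul_eq_zero.1 h3 with h | h
          · exact h
          · exact absurd (sub_eq_zero.1 h) (hθ k hk)
        rw [h0]
        have h2 : ∀ n : ℕ, fourier k (x + n • θ) = fourier k x * (fourier k θ) ^ n := by
          intro n
          induction n with
          | zero => simp
          | succ n ih =>
            rw [succ_nsmul, ← add_assoc, pow_succ, ← mul_assoc, ← ih]
            simp [fourier_apply, smul_add, AddCircle.toCircle_add]
        simp_rw [h2, ← Finset.mul_sum, geom_sum_eq (hθ k hk)]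
        have hn : ∀ t : UnitAddCircle, ‖fourier k t‖ = 1 := fun t => Circle.norm_coe _
        have hlim : Tendsto (fun N : ℕ => (1 / ((N : ℝ) + 1)) * (2 / ‖fourier k θ - 1‖)) atTop (𝓝 0) := by
          simpa using tendsto_one_div_add_atTop_nhds_zero_nat.mul_const (2 / ‖fourier k θ - 1‖)
        refine squeeze_zero_norm (fun N => ?_) hlim
        rw [norm_mul, norm_mul, norm_div, hn, one_mul, norm_inv, Complex.norm_real,
          Real.norm_of_nonneg (by positivity), one_div]
        gcongr
        refine (norm_sub_le _ _).trans ?_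
        rw [norm_pow, hn]; norm_num
    | zero => simp
    | add g₁ g₂ _ _ h1 h2 =>
      have := h1.add h2
      simp only [ContinuousMap.add_apply]
      rw [integral_add (hint _) (hint _)]
      refine this.congr fun N => ?_
      rw [Finset.sum_add_distrib, mul_add]
    | smul c g _ h1 =>
      have := h1.const_mul c
      simp only [ContinuousMap.smul_apply, smul_eq_mul]
      rw [integral_const_mul]
      refine this.congr fun N => ?_
      rw [← Finset.mul_sum]; ring
  rw [Metric.tendsto_atTop]
  intro ε hε
  obtain ⟨g, hg, hfg⟩ := Metric.mem_closure_iff.1 hcl (ε / 3) (by positivity)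
  obtain ⟨M, hM⟩ := Metric.tendsto_atTop.1 (hspan g hg) (ε / 3) (by positivity)
  refine ⟨M, fun N hN => ?_⟩
  have hpt : ∀ t, ‖f t - g t‖ ≤ ε / 3 := fun t => by
    rw [← dist_eq_norm]; exact (ContinuousMap.dist_apply_le_dist t).trans hfg.le
  have e1 : dist (((N + 1 : ℝ) : ℂ)⁻¹ * ∑ n ∈ Finset.range (N + 1), f (x + n • θ))
      (((N + 1 : ℝ) : ℂ)⁻¹ * ∑ n ∈ Finset.range (N + 1), g (x + n • θ)) ≤ ε / 3 := by
    rw [dist_eq_norm, ← mul_sub, ← Finset.sum_sub_distrib, norm_mul, norm_inv, Complex.norm_real,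
          Real.norm_of_nonneg (by positivity)]
    have : ‖∑ n ∈ Finset.range (N + 1), (f (x + n • θ) - g (x + n • θ))‖ ≤ (N + 1 : ℝ) * (ε / 3) := by
      refine (norm_sum_le_of_le _ (fun n _ => hpt _)).trans ?_
      simp
    rw [inv_mul_le_iff₀ (by positivity)]; exact this
  have e2 : dist (∫ t, g t) (∫ t, f t) ≤ ε / 3 := by
    rw [dist_comm, dist_eq_norm, ← integral_sub (hint _) (hint _)]
    refine (norm_integral_le_of_norm_le_const (C := ε / 3) (Eventually.of_forall hpt)).trans ?_
    simp [measureReal_def]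
  have := hM N hN
  calc _ ≤ _ := dist_triangle4 _ _ _ _
    _ < ε := by linarith

open MeasureTheory in
lemma weyl_set (θ x : UnitAddCircle) (hθ : ∀ k : ℤ, k ≠ 0 → fourier k θ ≠ 1)
    (E : Set UnitAddCircle) (hE : volume (frontier E) = 0) (p : ℕ → Prop) [DecidablePred p]
    (hp : ∀ n, p n ↔ x + n • θ ∈ E) :
    Tendsto (fun N : ℕ => (((Finset.range N).filter p).card : ℝ) / N) atTop
      (𝓝 (volume E).toReal) := by
  classical
  rw [← tendsto_add_atTop_iff_nat 1]
  have : IsProbabilityMeasure (volume : Measure UnitAddCircle) := ⟨UnitAddCircle.measure_univ⟩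
  let m : ℕ → Measure UnitAddCircle := fun N =>
    ((N + 1 : ℕ) : ENNReal)⁻¹ • ∑ n ∈ Finset.range (N + 1), Measure.dirac (x + n • θ)
  have hm : ∀ N, IsProbabilityMeasure (m N) := by
    intro N
    constructor
    simp only [m, Measure.smul_apply, Measure.finsetSum_apply, measure_univ, Finset.sum_const,
      Finset.card_range, smul_eq_mul, nsmul_eq_mul, mul_one]
    exact ENNReal.inv_mul_cancel (by simp) (by simp)
  let μs : ℕ → ProbabilityMeasure UnitAddCircle := fun N => ⟨m N, hm N⟩
  let μ : ProbabilityMeasure UnitAddCircle := ⟨volume, inferInstance⟩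
  have hlim : Tendsto μs atTop (𝓝 μ) := by
    rw [ProbabilityMeasure.tendsto_iff_forall_integral_rclike_tendsto ℂ]
    intro f
    have := weyl_aux θ x hθ f.toContinuousMap
    refine this.congr fun N => ?_
    change _ = ∫ t, f t ∂(m N)
    simp only [m]
    rw [integral_smul_measure, integral_finsetSum_measure]
    · have hN : (((N + 1 : ℕ) : ENNReal)⁻¹).toReal = ((N : ℝ) + 1)⁻¹ := by
        rw [ENNReal.toReal_inv, ENNReal.toReal_natCast]; push_cast; rfl
      rw [hN]
      simp [integral_dirac]
    · intro i _
      exact f.integrable _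
  have := ProbabilityMeasure.tendsto_measure_of_null_frontier_of_tendsto' hlim (E := E) hE
  have h2 := (ENNReal.tendsto_toReal (measure_ne_top (volume : Measure UnitAddCircle) E)).comp this
  refine h2.congr fun N => ?_
  change (m N E).toReal = _
  simp only [m, Measure.smul_apply, Measure.finsetSum_apply, smul_eq_mul, Measure.dirac_apply]
  rw [ENNReal.toReal_mul, ENNReal.toReal_inv, ENNReal.toReal_natCast, ENNReal.toReal_sum]
  · rw [inv_mul_eq_div]
    congr 1
    rw [Finset.card_filter]
    push_cast
    refine Finset.sum_congr rfl fun n _ => ?_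
    by_cases h : p n
    · simp [h, (hp n).1 h]
    · simp [h, mt (hp n).2 h]
  · intro n _
    by_cases h : x + n • θ ∈ E <;> simp [h]

open MeasureTheory in
lemma vol_arc (a c : ℝ) (ha : 0 ≤ a) (hac : a ≤ c) (hc : c ≤ 1) :
    (volume (((↑) : ℝ → UnitAddCircle) '' Set.Ioo a c)).toReal = c - a ∧
    (volume (((↑) : ℝ → UnitAddCircle) '' Set.Icc a c)).toReal = c - a ∧
    volume (frontier (((↑) : ℝ → UnitAddCircle) '' Set.Ioo a c)) = 0 ∧
    volume (frontier (((↑) : ℝ → UnitAddCircle) '' Set.Icc a c)) = 0 := by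
  set q : ℝ → UnitAddCircle := (↑) with hq
  have hopen : IsOpen (q '' Set.Ioo a c) := QuotientAddGroup.isOpenMap_coe _ isOpen_Ioo
  have hclosed : IsClosed (q '' Set.Icc a c) :=
    (isCompact_Icc.image (AddCircle.continuous_mk' 1)).isClosed
  have hsub : q '' Set.Ioo a c ⊆ q '' Set.Icc a c := Set.image_mono Set.Ioo_subset_Icc_self
  have hdiff : q '' Set.Icc a c \ q '' Set.Ioo a c ⊆ q '' {a, c} := by
    rintro _ ⟨⟨t, ht, rfl⟩, h2⟩
    refine ⟨t, ?_, rfl⟩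
    by_contra h3
    simp only [Set.mem_insert_iff, Set.mem_singleton_iff, not_or] at h3
    exact h2 ⟨t, ⟨lt_of_le_of_ne ht.1 (Ne.symm h3.1), lt_of_le_of_ne ht.2 h3.2⟩, rfl⟩
  have hsing : ∀ t : UnitAddCircle, volume ({t} : Set UnitAddCircle) = 0 := by
    intro t
    have := AddCircle.volume_closedBall 1 (x := t) 0
    rw [Metric.closedBall_zero] at this
    rw [this]; simp
  have hnull : volume (q '' {a, c}) = 0 := by
    rw [Set.image_pair, Set.insert_eq]
    exact measure_union_null (hsing _) (hsing _)
  have hdn := measure_mono_null hdiff hnull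
  have hvol : (volume (q '' Set.Ioo a c)) = ENNReal.ofReal (c - a) := by
    rw [AddCircle.add_projection_respects_measure 1 0 hopen.measurableSet, ← Real.volume_Ioo]
    congr 1
    ext t
    constructor
    · rintro ⟨⟨s, hs, hst⟩, ht⟩
      have hst' : (s : UnitAddCircle) = (t : UnitAddCircle) := hst
      rw [AddCircle.coe_eq_coe_iff_of_mem_Ioc (a := 0) (p := 1) ⟨by linarith [hs.1], by linarith [hs.2]⟩ ht] at hst'
      exact hst' ▸ hs
    · intro ht
      exact ⟨⟨t, ht, rfl⟩, by linarith [ht.1], by linarith [ht.2]⟩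
  have hvol2 : volume (q '' Set.Icc a c) = volume (q '' Set.Ioo a c) := by
    refine le_antisymm ?_ (measure_mono hsub)
    calc volume (q '' Set.Icc a c) ≤ volume (q '' Set.Ioo a c ∪ (q '' Set.Icc a c \ q '' Set.Ioo a c)) :=
          measure_mono (by rw [Set.union_sdiff_self]; exact Set.subset_union_right)
      _ ≤ _ := measure_union_le _ _
      _ = _ := by rw [hdn, add_zero]
  have h0 : 0 ≤ c - a := by linarith
  refine ⟨by rw [hvol, ENNReal.toReal_ofReal h0], by rw [hvol2, hvol, ENNReal.toReal_ofReal h0],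
    measure_mono_null ?_ hdn, measure_mono_null ?_ hdn⟩
  · rw [hopen.frontier_eq]
    exact Set.sdiff_subset_sdiff_left (closure_minimal hsub hclosed)
  · rw [hclosed.frontier_eq]
    exact Set.sdiff_subset_sdiff_right (hopen.subset_interior_iff.2 hsub)

lemma phi_bounds : 1 < phiGolden ∧ phiGolden < 2 := by
  have h1 : (2 : ℝ) < Real.sqrt 5 := Real.lt_sqrt_of_sq_lt (by norm_num)
  have h2 : Real.sqrt 5 < 3 := (Real.sqrt_lt' (by norm_num)).2 (by norm_num)
  unfold phiGolden
  constructor <;> linarith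

lemma fibWord_bounds (k : ℕ) : 0 ≤ (fibWord k : ℝ) ∧ (fibWord k : ℝ) ≤ 1 := by
  obtain ⟨h1, h2⟩ := phi_bounds
  have e : ((k : ℝ) + 2) * phiGolden = ((k : ℝ) + 1) * phiGolden + phiGolden := by ring
  have a1 : ⌊((k : ℝ) + 1) * phiGolden⌋ + 1 ≤ ⌊((k : ℝ) + 2) * phiGolden⌋ := by
    rw [Int.le_floor]; push_cast
    linarith [Int.floor_le (((k : ℝ) + 1) * phiGolden)]
  have a2 : ⌊((k : ℝ) + 2) * phiGolden⌋ < ⌊((k : ℝ) + 1) * phiGolden⌋ + 3 := by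
    rw [Int.floor_lt]; push_cast
    linarith [Int.lt_floor_add_one (((k : ℝ) + 1) * phiGolden)]
  have b1 : 0 ≤ fibWord k := by unfold fibWord; omega
  have b2 : fibWord k ≤ 1 := by unfold fibWord; omega
  exact ⟨by exact_mod_cast b1, by exact_mod_cast b2⟩

lemma fibDelta_bounds (b : ℝ) (hb : 1 < b) : 1 - 1 / b ≤ fibDelta b ∧ fibDelta b ≤ 1 := by
  have hb0 : 0 < b := by linarith
  have hr0 : 0 ≤ 1 / b := by positivity
  have hr1 : 1 / b < 1 := by rw [div_lt_one hb0]; exact hb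
  have hg := summable_geometric_of_lt_one hr0 hr1
  have hle : ∀ k : ℕ, (fibWord k : ℝ) * (1 / b) ^ k ≤ (1 / b) ^ k := fun k =>
    mul_le_of_le_one_left (by positivity) (fibWord_bounds k).2
  have hnn : ∀ k : ℕ, 0 ≤ (fibWord k : ℝ) * (1 / b) ^ k := fun k =>
    mul_nonneg (fibWord_bounds k).1 (by positivity)
  have hs := Summable.of_nonneg_of_le hnn hle hg
  have t1 : 0 ≤ ∑' k : ℕ, (fibWord k : ℝ) * (1 / b) ^ k := tsum_nonneg hnn
  have t2 : ∑' k : ℕ, (fibWord k : ℝ) * (1 / b) ^ k ≤ (1 - 1 / b)⁻¹ := by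
    rw [← tsum_geometric_of_lt_one hr0 hr1]; exact hs.tsum_le_tsum hle hg
  unfold fibDelta
  have h1 : 0 < 1 - 1 / b := by linarith
  have t3 := mul_le_mul_of_nonneg_left t2 (mul_nonneg hr0 h1.le)
  rw [mul_assoc (1 / b) _ ((1 - 1 / b)⁻¹), mul_inv_cancel₀ h1.ne'] at t3
  have t4 := mul_nonneg (mul_nonneg hr0 h1.le) t1
  constructor <;> linarith

lemma affine_lim (b v : ℝ) (hb : 1 < b) (u : ℕ → ℝ) (hu : ∀ n, u (n + 1) = u n / b + v) :
    Tendsto u atTop (𝓝 (b / (b - 1) * v)) := by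
  have hb0 : b ≠ 0 := by linarith
  have hb1 : b - 1 ≠ 0 := by linarith
  have key : ∀ n, u n = (1 / b) ^ n * (u 0 - b / (b - 1) * v) + b / (b - 1) * v := by
    intro n
    induction n with
    | zero => simp
    | succ n ih => rw [hu, ih, pow_succ]; field_simp; ring
  have h1 : Tendsto (fun n : ℕ => (1 / b) ^ n) atTop (𝓝 0) :=
    tendsto_pow_atTop_nhds_zero_of_lt_one (by positivity) (by rw [div_lt_one (by linarith)]; exact hb)
  have h2 := (h1.mul_const (u 0 - b / (b - 1) * v)).add_const (b / (b - 1) * v)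
  rw [zero_mul, zero_add] at h2
  exact h2.congr fun n => (key n).symm

lemma K_facts (b : ℝ) (hb : 1 < b) : ∃ A B : ℝ, Kset b = Set.Icc A B ∧ A ≤ rhoParam b ∧
    rhoParam b ≤ B ∧ rhoParam b / b + 500 = A ∧ rhoParam b / b + 1000 = B ∧
    A < b / (b - 1) * 1000 ∧ b / (b - 1) * 500 < B := by
  obtain ⟨d1, d2⟩ := fibDelta_bounds b hb
  have hb0 : 0 < b := by linarith
  have hb1 : 0 < b - 1 := by linarith
  have hr1 : 1 / b < 1 := by rw [div_lt_one hb0]; exact hb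
  have hC : 0 < 500 * b / (b - 1) := by positivity
  have hbd : b * (1 - fibDelta b) ≤ 1 := by
    have := mul_le_mul_of_nonneg_left d1 hb0.le
    rw [mul_sub, mul_one_div_cancel hb0.ne'] at this
    linarith
  have hbi : (b - 1) * (1 - fibDelta b) ≤ 1 - 1 / b := by
    have : (b - 1) * (1 - fibDelta b) = (1 - 1 / b) * (b * (1 - fibDelta b)) := by field_simp
    rw [this]
    exact mul_le_of_le_one_right (by linarith) hbd
  refine ⟨_, _, rfl, ?_, ?_, ?_, ?_, ?_, ?_⟩
  · unfold rhoParam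
    apply mul_le_mul_of_nonneg_left _ hC.le
    nlinarith
  · unfold rhoParam
    apply mul_le_mul_of_nonneg_left _ hC.le
    nlinarith
  · unfold rhoParam; field_simp; ring
  · unfold rhoParam; field_simp; ring
  · have : b / (b - 1) * 1000 = 500 * b / (b - 1) * 2 := by ring
    rw [this]
    apply mul_lt_mul_of_pos_left _ hC
    linarith
  · have : b / (b - 1) * 500 = 500 * b / (b - 1) * 1 := by ring
    rw [this]
    apply mul_lt_mul_of_pos_left _ hC
    linarith

lemma K_inv (b : ℝ) (hb : 1 < b) (x : ℝ) (hx : x ∈ Kset b) : fmap b x ∈ Kset b := by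
  obtain ⟨A, B, hK, h1, h2, h3, h4, h5, h6⟩ := K_facts b hb
  have hb0 : 0 < b := by linarith
  have hb1 : 0 < b - 1 := by linarith
  rw [hK] at hx ⊢
  have e5 : A / b + 1000 ≥ A := by
    rw [div_mul_eq_mul_div, lt_div_iff₀ hb1] at h5
    have : A ≤ A / b + 1000 := by
      rw [div_add' _ _ _ hb0.ne', le_div_iff₀ hb0]; linarith
    exact this
  have e6 : B / b + 500 ≤ B := by
    rw [div_mul_eq_mul_div, div_lt_iff₀ hb1] at h6
    rw [div_add' _ _ _ hb0.ne', div_le_iff₀ hb0]; linarith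
  have m1 : A / b ≤ x / b := div_le_div_of_nonneg_right hx.1 hb0.le
  have m2 : x / b ≤ B / b := div_le_div_of_nonneg_right hx.2 hb0.le
  unfold fmap
  split_ifs with hc
  · have := div_le_div_of_nonneg_right hc.le hb0.le
    constructor <;> linarith
  · have := div_le_div_of_nonneg_right (not_lt.1 hc) hb0.le
    constructor <;> linarith

lemma K_enter (b : ℝ) (hb : 1 < b) (x : ℝ) : ∃ n, (fmap b)^[n] x ∈ Kset b := by
  by_contra hno
  push Not at hno
  obtain ⟨A, B, hK, h1, h2, h3, h4, h5, h6⟩ := K_facts b hb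
  have hb0 : 0 < b := by linarith
  rw [hK] at hno
  have hAB : A ≤ B := h1.trans h2
  rcases lt_or_ge x A with hxA | hxA
  · have hall : ∀ n, (fmap b)^[n] x < A := by
      intro n
      induction n with
      | zero => exact hxA
      | succ n ih =>
        by_contra hge
        refine hno (n + 1) ⟨not_lt.1 hge, ?_⟩
        rw [Function.iterate_succ_apply', fmap, if_pos (by linarith)]
        have := div_le_div_of_nonneg_right (ih.le.trans h1) hb0.le
        linarith
    have := affine_lim b 1000 hb (fun n => (fmap b)^[n] x) (fun n => by
      rw [Function.iterate_succ_apply', fmap, if_pos (by linarith [hall n])])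
    have := le_of_tendsto' this (fun n => (hall n).le)
    linarith
  · have hxB : B < x := by
      by_contra hle
      exact hno 0 ⟨hxA, not_lt.1 hle⟩
    have hall : ∀ n, B < (fmap b)^[n] x := by
      intro n
      induction n with
      | zero => exact hxB
      | succ n ih =>
        by_contra hge
        refine hno (n + 1) ⟨?_, not_lt.1 hge⟩
        rw [Function.iterate_succ_apply', fmap, if_neg (by linarith)]
        have := div_le_div_of_nonneg_right (h2.trans ih.le) hb0.le
        linarith
    have := affine_lim b 500 hb (fun n => (fmap b)^[n] x) (fun n => by
      rw [Function.iterate_succ_apply', fmap, if_neg (by linarith [hall n])])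
    have := ge_of_tendsto' this (fun n => (hall n).le)
    linarith

lemma alpha_irr (k : ℤ) (hk : k ≠ 0) :
    fourier k ((alphaRot : ℝ) : UnitAddCircle) ≠ 1 := by
  intro h
  rw [fourier_coe_apply, Complex.exp_eq_one_iff] at h
  obtain ⟨m, hm⟩ := h
  have h2 : (2 * Real.pi * Complex.I : ℂ) ≠ 0 := Complex.two_pi_I_ne_zero
  have h3 : (2 * Real.pi * Complex.I : ℂ) * ((k : ℂ) * (alphaRot : ℂ)) =
      (2 * Real.pi * Complex.I : ℂ) * m := by
    rw [mul_comm _ (m : ℂ), ← hm]; push_cast; ring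
  have h4 := mul_left_cancel₀ h2 h3
  have h5 : (k : ℝ) * alphaRot = m := by exact_mod_cast h4
  have hirr : Irrational (Real.sqrt 5) := by
    have := Nat.Prime.irrational_sqrt (p := 5) (by norm_num)
    exact_mod_cast this
  apply hirr
  refine ⟨3 - 2 * (m : ℚ) / k, ?_⟩
  have hk' : (k : ℝ) ≠ 0 := by exact_mod_cast hk
  push_cast
  unfold alphaRot at h5
  rw [← h5]
  field_simp
  ring

lemma Trot_coe (y : ℝ) : ((Trot y : ℝ) : UnitAddCircle) = (y : UnitAddCircle) + (alphaRot : ℝ) := by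
  unfold Trot
  split_ifs
  · rfl
  · rw [AddCircle.coe_sub, AddCircle.coe_period, sub_zero]; rfl

theorem stmt16 (b : ℝ) (hb : 1 < b) (h : ℝ → ℝ)
    (hcont : ContinuousOn h (Kset b)) (hmono : MonotoneOn h (Kset b))
    (hmaps : Set.MapsTo h (Kset b) (Set.Icc 0 1))
    (hsurj : Set.SurjOn h (Kset b) (Set.Icc 0 1))
    (hsemi : ∀ x ∈ Kset b, h (fmap b x) = Trot (h x)) :
    ∀ J : Set ℝ, J ⊆ Kset b → J.OrdConnected →
      ∀ S₀ : ℝ, 0 ≤ S₀ →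
        Tendsto (fun N => (visitCount (fmap b) S₀ J N : ℝ) / N) atTop
          (𝓝 (MeasureTheory.volume (h '' J)).toReal) := by
  classical
  intro J hJ hJo S₀ _
  rcases J.eq_empty_or_nonempty with rfl | hne
  · simp [visitCount]
  obtain ⟨n₀, hn₀⟩ := K_enter b hb S₀
  have hK : ∀ m, (fmap b)^[n₀ + m] S₀ ∈ Kset b := by
    intro m
    induction m with
    | zero => exact hn₀
    | succ m ih =>
      rw [← add_assoc, Function.iterate_succ_apply']
      exact K_inv b hb _ ih
  set z : ℕ → ℝ := fun n => (fmap b)^[n] S₀ with hz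
  set θ : UnitAddCircle := ((alphaRot : ℝ) : UnitAddCircle) with hθ
  set x₀ : UnitAddCircle := ((h (z n₀) : ℝ) : UnitAddCircle) - n₀ • θ with hx₀
  have hzc : ∀ m, ((h (z (n₀ + m)) : ℝ) : UnitAddCircle) = x₀ + (n₀ + m) • θ := by
    intro m
    induction m with
    | zero => simp [hx₀]
    | succ m ih =>
      have : z (n₀ + (m + 1)) = fmap b (z (n₀ + m)) := by
        simp only [hz]
        rw [← add_assoc, Function.iterate_succ_apply']
      rw [this, hsemi _ (hK m), Trot_coe, ih, ← add_assoc n₀, succ_nsmul _ (n₀ + m), add_assoc]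
  have hne' : (h '' J).Nonempty := hne.image h
  have h01 : h '' J ⊆ Set.Icc 0 1 := by
    rintro _ ⟨x, hx, rfl⟩; exact hmaps (hJ hx)
  have hbb : BddBelow (h '' J) := ⟨0, fun y hy => (h01 hy).1⟩
  have hba : BddAbove (h '' J) := ⟨1, fun y hy => (h01 hy).2⟩
  set a := sInf (h '' J) with ha
  set c := sSup (h '' J) with hc
  have hIcc : h '' J ⊆ Set.Icc a c := fun y hy => ⟨csInf_le hbb hy, le_csSup hba hy⟩
  have ha0 : 0 ≤ a := le_csInf hne' fun y hy => (h01 hy).1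
  have hc1 : c ≤ 1 := csSup_le hne' fun y hy => (h01 hy).2
  have hac : a ≤ c := by
    obtain ⟨y, hy⟩ := hne'
    exact (hIcc hy).1.trans (hIcc hy).2
  have hback : ∀ x ∈ Kset b, h x ∈ Set.Ioo a c → x ∈ J := by
    intro x hx hxx
    obtain ⟨_, ⟨j, hj, rfl⟩, hj2⟩ := exists_lt_of_csInf_lt hne' hxx.1
    obtain ⟨_, ⟨j', hj', rfl⟩, hj2'⟩ := exists_lt_of_lt_csSup hne' hxx.2
    refine hJo.out hj hj' ⟨?_, ?_⟩
    · by_contra hcon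
      exact absurd (hmono hx (hJ hj) (not_le.1 hcon).le) (not_le.2 hj2)
    · by_contra hcon
      exact absurd (hmono (hJ hj') hx (not_le.1 hcon).le) (not_le.2 hj2')
  have hIoo : Set.Ioo a c ⊆ h '' J := by
    intro t ht
    obtain ⟨x, hx, rfl⟩ := hsurj (show t ∈ Set.Icc (0 : ℝ) 1 from
      ⟨ha0.trans ht.1.le, ht.2.le.trans hc1⟩)
    exact ⟨x, hback x hx ht, rfl⟩
  have hvol : (MeasureTheory.volume (h '' J)).toReal = c - a := by
    have e : MeasureTheory.volume (h '' J) = ENNReal.ofReal (c - a) := by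
      apply le_antisymm
      · rw [← Real.volume_Icc]; exact MeasureTheory.measure_mono hIcc
      · rw [← Real.volume_Ioo]; exact MeasureTheory.measure_mono hIoo
    rw [e, ENNReal.toReal_ofReal (by linarith)]
  rw [hvol]
  obtain ⟨v1, v2, f1, f2⟩ := vol_arc a c ha0 hac hc1
  have L1 := weyl_set θ x₀ alpha_irr _ f1 (fun n => x₀ + n • θ ∈ _) (fun n => Iff.rfl)
  have L2 := weyl_set θ x₀ alpha_irr _ f2 (fun n => x₀ + n • θ ∈ _) (fun n => Iff.rfl)
  rw [v1] at L1
  rw [v2] at L2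
  have hz0 : Tendsto (fun N : ℕ => (n₀ : ℝ) / N) atTop (𝓝 0) :=
    tendsto_const_div_atTop_nhds_zero_nat _
  have L1' := L1.sub hz0
  have L2' := L2.add hz0
  rw [sub_zero] at L1'
  rw [add_zero] at L2'
  refine tendsto_of_tendsto_of_tendsto_of_le_of_le L1' L2' (fun N => ?_) (fun N => ?_)
  · simp only
    rw [← sub_div]
    refine div_le_div_of_nonneg_right ?_ (Nat.cast_nonneg N)
    rw [sub_le_iff_le_add]
    norm_cast
    refine (Finset.card_le_card (t := (Finset.range N).filter (fun n => z n ∈ J) ∪ Finset.range n₀)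
      ?_).trans ((Finset.card_union_le _ _).trans ?_)
    · intro n hn
      simp only [Finset.mem_filter, Finset.mem_union, Finset.mem_range] at hn ⊢
      by_cases hlt : n < n₀
      · exact Or.inr hlt
      · left
        refine ⟨hn.1, ?_⟩
        obtain ⟨m, rfl⟩ := Nat.exists_eq_add_of_le (not_lt.1 hlt)
        refine hback _ (hK m) ?_
        obtain ⟨t, ht, hte⟩ := hn.2
        rw [← hzc m] at hte
        have hy := hmaps (hK m)
        have ht01 : 0 < t ∧ t < 1 := ⟨lt_of_le_of_lt ha0 ht.1, lt_of_lt_of_le ht.2 hc1⟩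
        have hty : t = h (z (n₀ + m)) := by
          rcases lt_or_ge (h (z (n₀ + m))) 1 with hlt1 | hge1
          · exact (AddCircle.coe_eq_coe_iff_of_mem_Ico (p := 1) (a := 0)
              ⟨ht01.1.le, by linarith [ht01.2]⟩ ⟨hy.1, by simpa using hlt1⟩).1 hte
          · exact (AddCircle.coe_eq_coe_iff_of_mem_Ioc (p := 1) (a := 0)
              ⟨ht01.1, by linarith [ht01.2]⟩ ⟨by linarith, by simpa using hy.2⟩).1 hte
        exact hty ▸ ht
    · rw [Finset.card_range]
      refine Nat.add_le_add_right (le_of_eq ?_) _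
      unfold visitCount
      congr
  · simp only
    rw [← add_div]
    refine div_le_div_of_nonneg_right ?_ (Nat.cast_nonneg N)
    norm_cast
    refine le_trans ?_ ((Finset.card_union_le _ (Finset.range n₀)).trans
      (Nat.add_le_add_left (Finset.card_range n₀).le _))
    refine le_trans (b := ((Finset.range N).filter (fun n => z n ∈ J)).card) (le_of_eq ?_)
      (Finset.card_le_card ?_)
    · unfold visitCount
      congr
    · intro n hn
      simp only [Finset.mem_filter, Finset.mem_union, Finset.mem_range] at hn ⊢
      by_cases hlt : n < n₀
      · exact Or.inr hlt
      · left
        refine ⟨hn.1, ?_⟩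
        obtain ⟨m, rfl⟩ := Nat.exists_eq_add_of_le (not_lt.1 hlt)
        rw [← hzc m]
        exact ⟨_, hIcc ⟨_, hn.2, rfl⟩, rfl⟩
end

section
/- Let b > 1, let δ be defined from the Fibonacci word, and let f be the piecewise-affine contraction of [0,∞) with parameters v₁ = 1000, v₂ = 500, r = 1/b − 1 and ρ = (500b/(b−1))·(b(1−δ)+1). Then the financial process defined by f is chaotic: there exists a Cantor set C ⊂ [0,∞) such that (C1) ω_f(S₀) = C for every S₀ ≥ 0; (C2) there exists η > 0 such that for every S₀ ∈ C and every ε > 0 there exist S₀' ≥ 0 and k ∈ ℕ with |S₀' − S₀| ≤ ε and |f^k(S₀') − f^k(S₀)| ≥ η; and (C3) for every interval J ⊂ [0,∞) there exists c_J ≥ 0 such that lim_{N→∞} (1/N)·#{0 ≤ n ≤ N−1 : fⁿ(S₀) ∈ J} = c_J for every S₀ ≥ 0. -/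
open Filter Topology

/-! Equidistribution of irrational rotations -/

noncomputable def sF (α : ℝ) (N : ℕ) (x : ℝ) : ℝ := ∑ n ∈ Finset.range N, Int.fract (x + n * α)

lemma sF_step (α : ℝ) (N : ℕ) (x : ℝ) : |sF α N (x + α) - sF α N x| ≤ 1 := by
  have h : sF α N (x + α) - sF α N x = Int.fract (x + N * α) - Int.fract x := by
    unfold sF
    rw [← Finset.sum_sub_distrib]
    have := Finset.sum_range_sub (fun n : ℕ => Int.fract (x + n * α)) N
    simp only [Nat.cast_zero, zero_mul, add_zero] at this
    rw [← this]
    refine Finset.sum_congr rfl fun n _ => ?_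
    congr 2
    push_cast; ring
  rw [h, abs_le]
  have h1 := Int.fract_nonneg (x + N * α)
  have h2 := Int.fract_lt_one (x + N * α)
  have h3 := Int.fract_nonneg x
  have h4 := Int.fract_lt_one x
  constructor <;> linarith

lemma sF_nat (α : ℝ) (N m : ℕ) (x : ℝ) : |sF α N (x + m * α) - sF α N x| ≤ m := by
  induction m with
  | zero => simp
  | succ m ih =>
    have h := sF_step α N (x + m * α)
    have e : x + ((m + 1 : ℕ) : ℝ) * α = x + m * α + α := by push_cast; ring
    rw [e]
    push_cast
    rw [abs_le] at *
    constructor <;> linarith [h.1, h.2, ih.1, ih.2]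

lemma sF_int (α : ℝ) (N : ℕ) (m : ℤ) (x : ℝ) : |sF α N (x + m * α) - sF α N x| ≤ |(m : ℝ)| := by
  obtain ⟨k, rfl | rfl⟩ := m.eq_nat_or_neg
  · simpa using sF_nat α N k x
  · have := sF_nat α N k (x - k * α)
    rw [sub_add_cancel, abs_sub_comm] at this
    simpa [sub_eq_add_neg] using this

lemma sF_per (α : ℝ) (N : ℕ) (m : ℤ) (x : ℝ) : sF α N (x + m) = sF α N x := by
  unfold sF
  refine Finset.sum_congr rfl fun n _ => ?_
  rw [add_right_comm, Int.fract_add_intCast]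

lemma sF_lip (α : ℝ) (N : ℕ) {x y : ℝ} (h : x ≤ y) : sF α N y - sF α N x ≤ N * (y - x) := by
  unfold sF
  rw [← Finset.sum_sub_distrib]
  have : (N : ℝ) * (y - x) = ∑ n ∈ Finset.range N, (y - x) := by simp; ring
  rw [this]
  refine Finset.sum_le_sum fun n _ => ?_
  have h1 : (⌊x + n * α⌋ : ℝ) ≤ ⌊y + n * α⌋ := by
    exact_mod_cast Int.floor_mono (by linarith)
  unfold Int.fract
  linarith

lemma int_dense {α : ℝ} (hα : Irrational α) {a b : ℝ} (h : a < b) :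
    ∃ m k : ℤ, a < m * α + k ∧ m * α + k < b := by
  have hd : Dense (AddSubgroup.closure {α, 1} : Set ℝ) := by
    rw [dense_addSubgroupClosure_pair_iff]; simpa using hα
  obtain ⟨z, hz, hz'⟩ := hd.exists_between h
  rw [SetLike.mem_coe, AddSubgroup.mem_closure_pair] at hz
  obtain ⟨m, k, rfl⟩ := hz
  exact ⟨m, k, by simpa using hz'.1, by simpa using hz'.2⟩

lemma sF_diff_le {α : ℝ} (hα : Irrational α) (x y : ℝ) {ε : ℝ} (hε : 0 < ε) :
    ∀ᶠ N : ℕ in atTop, (sF α N x - sF α N y) / N < ε := by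
  obtain ⟨m, k, h1, h2⟩ := int_dense hα (show x - y - ε / 2 < x - y by linarith)
  have ht : Tendsto (fun N : ℕ => |(m : ℝ)| / N) atTop (𝓝 0) :=
    tendsto_const_div_atTop_nhds_zero_nat _
  filter_upwards [ht.eventually (gt_mem_nhds (half_pos hε)), eventually_gt_atTop 0] with N hN hN0
  have hN0' : (0 : ℝ) < N := by exact_mod_cast hN0
  have e1 := sF_int α N m y
  have e2 := sF_per α N k (y + m * α)
  have e3 := sF_lip α N (show y + m * α + k ≤ x by linarith)
  have e4 : (N : ℝ) * (x - (y + m * α + k)) ≤ N * (ε / 2) := by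
    apply mul_le_mul_of_nonneg_left _ hN0'.le
    linarith
  rw [div_lt_iff₀ hN0'] at *
  have := (abs_le.1 e1).2
  linarith

lemma sF_diff {α : ℝ} (hα : Irrational α) (x y : ℝ) :
    Tendsto (fun N : ℕ => (sF α N x - sF α N y) / N) atTop (𝓝 0) := by
  rw [tendsto_order]
  refine ⟨fun a ha => ?_, fun a ha => sF_diff_le hα x y ha⟩
  filter_upwards [sF_diff_le hα y x (show 0 < -a by linarith)] with N hN
  have : (sF α N y - sF α N x) / N = -((sF α N x - sF α N y) / N) := by ring
  linarith

lemma floor_avg {α : ℝ} (hα : Irrational α) (x a b : ℝ) :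
    Tendsto (fun N : ℕ => (∑ n ∈ Finset.range N,
      ((⌊x + n * α - a⌋ : ℝ) - ⌊x + n * α - b⌋)) / N) atTop (𝓝 (b - a)) := by
  have h := (sF_diff hα (x - b) (x - a)).const_add (b - a)
  rw [add_zero] at h
  refine h.congr' ?_
  filter_upwards [eventually_gt_atTop 0] with N hN0
  have hN0' : (N : ℝ) ≠ 0 := by positivity
  have e : ∑ n ∈ Finset.range N, ((⌊x + n * α - a⌋ : ℝ) - ⌊x + n * α - b⌋)
      = N * (b - a) + (sF α N (x - b) - sF α N (x - a)) := by
    unfold sF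
    rw [← Finset.sum_sub_distrib]
    have : (N : ℝ) * (b - a) = ∑ n ∈ Finset.range N, (b - a) := by simp; ring
    rw [this, ← Finset.sum_add_distrib]
    refine Finset.sum_congr rfl fun n _ => ?_
    unfold Int.fract
    rw [show x - b + n * α = x + n * α - b by ring, show x - a + n * α = x + n * α - a by ring]
    ring
  rw [e]
  field_simp

lemma freq_congr {A B : ℕ → Prop} [DecidablePred A] [DecidablePred B] (h : ∀ᶠ n in atTop, (A n ↔ B n)) {c : ℝ}
    (hA : Tendsto (fun N : ℕ => (((Finset.range N).filter A).card : ℝ) / N) atTop (𝓝 c)) :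
    Tendsto (fun N : ℕ => (((Finset.range N).filter B).card : ℝ) / N) atTop (𝓝 c) := by
  have h0 : Tendsto (fun n => (if B n then (1 : ℝ) else 0) - (if A n then (1 : ℝ) else 0))
      atTop (𝓝 0) := by
    refine tendsto_const_nhds.congr' ?_
    filter_upwards [h] with n hn
    simp [hn]
  have h1 := hA.add h0.cesaro
  rw [add_zero] at h1
  refine h1.congr fun N => ?_
  rw [Finset.sum_sub_distrib, Finset.sum_boole, Finset.sum_boole]
  ring

open scoped Classical in
lemma freq_rot {α : ℝ} (hα : Irrational α) (x : ℝ) {e s : ℝ} (h0 : 0 ≤ e) (hes : e ≤ s)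
    (h1 : s ≤ 1) :
    Tendsto (fun N : ℕ => (((Finset.range N).filter
      (fun n : ℕ => e ≤ Int.fract (x + n * α) ∧ Int.fract (x + n * α) < s)).card : ℝ) / N)
      atTop (𝓝 (s - e)) := by
  refine (floor_avg hα x e s).congr fun N => ?_
  congr 1
  rw [← Finset.sum_boole]
  refine Finset.sum_congr rfl fun n _ => ?_
  generalize x + n * α = z
  have f0 := Int.fract_nonneg z
  have f1 := Int.fract_lt_one z
  have hz := Int.floor_add_fract z
  have key : ∀ t, 0 ≤ t → t ≤ 1 → (⌊z - t⌋ : ℝ) = ⌊z⌋ - if Int.fract z < t then 1 else 0 := by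
    intro t t0 t1
    split_ifs with h
    · have : ⌊z - t⌋ = ⌊z⌋ - 1 := by
        rw [Int.floor_eq_iff]; push_cast; constructor <;> linarith
      rw [this]; push_cast; ring
    · have : ⌊z - t⌋ = ⌊z⌋ := by
        rw [Int.floor_eq_iff]; constructor <;> linarith
      rw [this]; ring
  rw [key e h0 (by linarith), key s (by linarith) h1]
  by_cases a1 : Int.fract z < e
  · have a2 : Int.fract z < s := by linarith
    simp [a1, a2]
  · have a1' := a1
    push Not at a1'
    by_cases a2 : Int.fract z < s <;> simp [a1, a2, a1']

lemma nat_dense {α : ℝ} (hα : Irrational α) (x : ℝ) {a b : ℝ} (h : a < b) (M : ℕ) :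
    ∃ n ≥ M, ∃ k : ℤ, a < x + n * α + k ∧ x + n * α + k < b := by
  by_contra! hc
  obtain ⟨a', ha1, ha2⟩ := exists_between h
  have h0 : Tendsto (fun N : ℕ => (∑ n ∈ Finset.range N,
      ((⌊x + n * α - a'⌋ : ℝ) - ⌊x + n * α - b⌋)) / N) atTop (𝓝 0) := by
    have : Tendsto (fun n : ℕ => ((⌊x + n * α - a'⌋ : ℝ) - ⌊x + n * α - b⌋)) atTop (𝓝 0) := by
      refine tendsto_const_nhds.congr' ?_
      filter_upwards [eventually_ge_atTop M] with n hn
      have l1 : ⌊x + n * α - b⌋ ≤ ⌊x + n * α - a'⌋ := Int.floor_mono (by linarith)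
      rcases l1.eq_or_lt with l2 | l2
      · rw [l2]; ring
      · exfalso
        have f1 := Int.floor_le (x + n * α - a')
        have f2 := hc n hn (-⌊x + n * α - a'⌋) (by push_cast; linarith)
        rw [Int.floor_lt] at l2
        push_cast at f2
        linarith
    simpa [div_eq_inv_mul] using this.cesaro
  have := tendsto_nhds_unique h0 (floor_avg hα x a' b)
  linarith

lemma rot_inj {α : ℝ} (hα : Irrational α) (x e : ℝ) :
    ∀ᶠ n : ℕ in atTop, Int.fract (x + n * α) ≠ e := by
  have : ({n : ℕ | Int.fract (x + n * α) = e}).Subsingleton := by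
    intro n hn m hm
    by_contra hne
    have h := hn.trans hm.symm
    rw [Int.fract_eq_fract] at h
    obtain ⟨z, hz⟩ := h
    have hnm : ((n : ℤ) - m) ≠ 0 := by omega
    refine (hα.intCast_mul hnm).ne_int z ?_
    push_cast; linarith
  have hf := this.finite
  rw [← Nat.cofinite_eq_atTop]
  exact hf.compl_mem_cofinite

/-! The conjugating map -/

noncomputable def Pt (α : ℝ) (u : ℝ) (k : ℕ) : ℝ :=
  (⌊u - (k + 1) * α⌋ : ℝ) - ⌊-((k + 1) * α)⌋

noncomputable def Ph (q α : ℝ) (u : ℝ) : ℝ := (1 - q) * ∑' k : ℕ, q ^ k * Pt α u k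

lemma Pt_bound (α u : ℝ) (k : ℕ) : |Pt α u k| ≤ |u| + 1 := by
  unfold Pt
  have h1 := Int.floor_le (u - (k + 1) * α)
  have h2 := Int.lt_floor_add_one (u - (k + 1) * α)
  have h3 := Int.floor_le (-((k + 1) * α))
  have h4 := Int.lt_floor_add_one (-((k + 1) * α))
  have h5 := neg_abs_le u
  have h6 := le_abs_self u
  rw [abs_le]
  constructor <;> linarith

lemma Pt_mono (α : ℝ) {u v : ℝ} (h : u ≤ v) (k : ℕ) : Pt α u k ≤ Pt α v k := by
  unfold Pt
  have : (⌊u - (k + 1) * α⌋ : ℝ) ≤ ⌊v - (k + 1) * α⌋ := by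
    exact_mod_cast Int.floor_mono (by linarith)
  linarith

section
variable {q α : ℝ}

lemma Ph_term (q α : ℝ) (hq0 : 0 < q) {u C : ℝ} (h : |u| ≤ C) (k : ℕ) :
    ‖q ^ k * Pt α u k‖ ≤ q ^ k * (C + 1) := by
  rw [norm_mul, Real.norm_eq_abs, Real.norm_eq_abs, abs_of_pos (pow_pos hq0 k)]
  exact mul_le_mul_of_nonneg_left ((Pt_bound α u k).trans (by linarith)) (pow_pos hq0 k).le

lemma Ph_summable (α : ℝ) (hq0 : 0 < q) (hq1 : q < 1) (u : ℝ) :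
    Summable fun k : ℕ => q ^ k * Pt α u k :=
  Summable.of_norm_bounded
    ((summable_geometric_of_lt_one hq0.le hq1).mul_right _) (Ph_term q α hq0 le_rfl)

lemma Ph_zero (q α : ℝ) : Ph q α 0 = 0 := by
  simp [Ph, Pt]

lemma Ph_mono (α : ℝ) (hq0 : 0 < q) (hq1 : q < 1) : Monotone (Ph q α) := by
  intro u v h
  refine mul_le_mul_of_nonneg_left ?_ (by linarith)
  exact (Ph_summable α hq0 hq1 u).tsum_le_tsum
    (fun k => mul_le_mul_of_nonneg_left (Pt_mono α h k) (pow_pos hq0 k).le)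
    (Ph_summable α hq0 hq1 v)

lemma Ph_add_int (α : ℝ) (hq0 : 0 < q) (hq1 : q < 1) (u : ℝ) (n : ℤ) :
    Ph q α (u + n) = Ph q α u + n := by
  unfold Ph
  have e : ∀ k : ℕ, q ^ k * Pt α (u + n) k = q ^ k * Pt α u k + q ^ k * n := by
    intro k
    unfold Pt
    rw [show u + n - (k + 1) * α = u - (k + 1) * α + n by ring, Int.floor_add_intCast]
    push_cast; ring
  simp_rw [e]
  rw [(Ph_summable α hq0 hq1 u).tsum_add
    ((summable_geometric_of_lt_one hq0.le hq1).mul_right _), tsum_mul_right,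
    tsum_geometric_of_lt_one hq0.le hq1]
  have : 1 - q ≠ 0 := by linarith
  field_simp

lemma Ph_int (α : ℝ) (hq0 : 0 < q) (hq1 : q < 1) (n : ℤ) : Ph q α n = n := by
  have := Ph_add_int α hq0 hq1 0 n
  simpa [Ph_zero] using this

lemma Ph_func (α : ℝ) (hq0 : 0 < q) (hq1 : q < 1) (u : ℝ) :
    Ph q α (u + α) = q * Ph q α u + Ph q α α + (1 - q) * ⌊u⌋ := by
  have h1 : ∑' k : ℕ, q ^ k * Pt α (u + α) k - ∑' k : ℕ, q ^ k * Pt α α k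
      = ⌊u⌋ + q * ∑' k : ℕ, q ^ k * Pt α u k := by
    rw [← (Ph_summable α hq0 hq1 (u + α)).tsum_sub (Ph_summable α hq0 hq1 α),
      Summable.tsum_eq_zero_add ((Ph_summable α hq0 hq1 (u + α)).sub (Ph_summable α hq0 hq1 α)),
      ← tsum_mul_left]
    congr 1
    · simp [Pt]
    · refine tsum_congr fun k => ?_
      unfold Pt
      push_cast
      rw [show u + α - (k + 1 + 1) * α = u - (k + 1) * α by ring,
        show α - (k + 1 + 1) * α = -((k + 1) * α) by ring]
      ring
  unfold Ph
  linear_combination (1 - q) * h1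

lemma Ph_jump (α : ℝ) (hq0 : 0 < q) (hq1 : q < 1) (k : ℕ) (m : ℤ) {u : ℝ}
    (hu : u < (k + 1) * α + m) :
    Ph q α u + (1 - q) * q ^ k ≤ Ph q α ((k + 1) * α + m) := by
  have hle : ∀ j : ℕ, q ^ j * Pt α u j + (if j = k then q ^ k else 0)
      ≤ q ^ j * Pt α ((k + 1) * α + m) j := by
    intro j
    split_ifs with h
    · subst h
      have : Pt α u j + 1 ≤ Pt α ((j + 1) * α + m) j := by
        unfold Pt
        rw [show (j + 1) * α + m - (j + 1) * α = (m : ℝ) by ring, Int.floor_intCast]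
        have : ⌊u - (j + 1) * α⌋ + 1 ≤ m := by
          rw [Int.add_one_le_iff, Int.floor_lt]; linarith
        have : (⌊u - (j + 1) * α⌋ : ℝ) + 1 ≤ m := by exact_mod_cast this
        linarith
      nlinarith [pow_pos hq0 j]
    · simpa using mul_le_mul_of_nonneg_left (Pt_mono α hu.le j) (pow_pos hq0 j).le
  have hs : Summable fun j : ℕ => if j = k then q ^ k else 0 :=
    (hasSum_ite_eq k (q ^ k)).summable
  have := ((Ph_summable α hq0 hq1 u).add hs).tsum_le_tsum hle (Ph_summable α hq0 hq1 _)
  rw [(Ph_summable α hq0 hq1 u).tsum_add hs, tsum_ite_eq] at this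
  unfold Ph
  nlinarith

lemma jump_dense {α : ℝ} (hα : Irrational α) {a b : ℝ} (h : a < b) :
    ∃ (k : ℕ) (m : ℤ), a < (k + 1) * α + m ∧ (k + 1) * α + m < b := by
  obtain ⟨n, hn, k, h1, h2⟩ := nat_dense hα 0 h 1
  obtain ⟨n, rfl⟩ := Nat.exists_eq_add_of_le' hn
  refine ⟨n, k, ?_, ?_⟩
  · simpa using h1
  · simpa using h2

lemma Ph_strictMono (hα : Irrational α) (hq0 : 0 < q) (hq1 : q < 1) : StrictMono (Ph q α) := by
  intro a b h
  obtain ⟨k, m, h1, h2⟩ := jump_dense hα h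
  have e1 := Ph_jump α hq0 hq1 k m h1
  have e2 := Ph_mono α hq0 hq1 h2.le
  have : 0 < (1 - q) * q ^ k := mul_pos (by linarith) (pow_pos hq0 k)
  linarith

lemma Ph_tendsto (α : ℝ) (hq0 : 0 < q) (hq1 : q < 1) (x : ℝ) {l : Filter ℝ} (hl : l ≤ 𝓝 x)
    (h : ∀ k : ℕ, ∀ᶠ u in l, Pt α u k = Pt α x k) :
    Tendsto (Ph q α) l (𝓝 (Ph q α x)) := by
  refine Tendsto.const_mul _ ?_
  refine tendsto_tsum_of_dominated_convergence (bound := fun k => q ^ k * (|x| + 1 + 1))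
    ((summable_geometric_of_lt_one hq0.le hq1).mul_right _) ?_ ?_
  · intro k
    refine tendsto_const_nhds.congr' ?_
    filter_upwards [h k] with u hu
    rw [hu]
  · have : ∀ᶠ u in l, |u| < |x| + 1 :=
      hl (continuous_abs.continuousAt.eventually (gt_mem_nhds (by linarith)))
    filter_upwards [this] with u hu k
    exact Ph_term q α hq0 hu.le k

lemma Ph_right (α : ℝ) (hq0 : 0 < q) (hq1 : q < 1) (x : ℝ) :
    Tendsto (Ph q α) (𝓝[>] x) (𝓝 (Ph q α x)) := by
  refine Ph_tendsto α hq0 hq1 x nhdsWithin_le_nhds fun k => ?_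
  have hlt := Int.lt_floor_add_one (x - (k + 1) * α)
  have hle := Int.floor_le (x - (k + 1) * α)
  have : Set.Ioo x (⌊x - (k + 1) * α⌋ + 1 + (k + 1) * α) ∈ 𝓝[>] x :=
    Ioo_mem_nhdsGT (by linarith)
  filter_upwards [this] with u hu
  unfold Pt
  have : ⌊u - (k + 1) * α⌋ = ⌊x - (k + 1) * α⌋ := by
    rw [Int.floor_eq_iff]
    constructor <;> linarith [hu.1, hu.2]
  rw [this]

lemma Ph_left (hα : Irrational α) (hq0 : 0 < q) (hq1 : q < 1) (n : ℤ) :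
    Tendsto (Ph q α) (𝓝[<] (n : ℝ)) (𝓝 (n : ℝ)) := by
  have := Ph_tendsto α hq0 hq1 (n : ℝ) (l := 𝓝[<] (n : ℝ)) nhdsWithin_le_nhds fun k => ?_
  · rwa [Ph_int α hq0 hq1] at this
  have hlt := Int.lt_floor_add_one (n - (k + 1) * α)
  have hle := Int.floor_le (n - (k + 1) * α)
  have hle' : (⌊n - (k + 1) * α⌋ : ℝ) < n - (k + 1) * α := by
    refine lt_of_le_of_ne hle fun hh => ?_
    refine (hα.natCast_mul (show k + 1 ≠ 0 by omega)).ne_int (n - ⌊n - (k + 1) * α⌋) ?_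
    push_cast; linarith
  have : Set.Ioo (⌊n - (k + 1) * α⌋ + (k + 1) * α) (n : ℝ) ∈ 𝓝[<] (n : ℝ) :=
    Ioo_mem_nhdsLT (by linarith)
  filter_upwards [this] with u hu
  unfold Pt
  have : ⌊u - (k + 1) * α⌋ = ⌊n - (k + 1) * α⌋ := by
    rw [Int.floor_eq_iff]
    constructor <;> linarith [hu.1, hu.2]
  rw [this]

end

/-- `x` is the rotation coordinate of `y`. -/
def Br (P : ℝ → ℝ) (y x : ℝ) : Prop := (∀ u < x, P u ≤ y) ∧ (∀ u > x, y ≤ P u)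

section
variable {q α : ℝ}

lemma Br_int (hα : Irrational α) (hq0 : 0 < q) (hq1 : q < 1) {y x : ℝ} (h : Br (Ph q α) y x)
    (n : ℤ) : (n : ℝ) ≤ y ↔ (n : ℝ) ≤ x := by
  constructor
  · intro hy
    by_contra! hx
    obtain ⟨u, h1, h2⟩ := exists_between hx
    have e1 := h.2 u h1
    have e2 := Ph_strictMono hα hq0 hq1 h2
    rw [Ph_int α hq0 hq1] at e2
    linarith
  · intro hx
    refine le_of_tendsto (Ph_left hα hq0 hq1 n) ?_
    filter_upwards [self_mem_nhdsWithin] with u hu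
    exact h.1 u (lt_of_lt_of_le hu hx)

lemma Br_exists (hα : Irrational α) (hq0 : 0 < q) (hq1 : q < 1) {y : ℝ} (h0 : 0 ≤ y) (h1 : y < 1) :
    ∃ x, 0 ≤ x ∧ x < 1 ∧ Br (Ph q α) y x := by
  have e0 := Ph_int α hq0 hq1 0
  have e1 := Ph_int α hq0 hq1 1
  push_cast at e0 e1
  have hm := Ph_mono α hq0 hq1
  have hbd : BddAbove {u | Ph q α u ≤ y} := ⟨1, fun u hu => by
    by_contra! hc
    have := hm hc.le
    have := hu.out
    linarith⟩
  have hne : ({u | Ph q α u ≤ y}).Nonempty := ⟨0, by simpa [e0] using h0⟩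
  have hB : Br (Ph q α) y (sSup {u | Ph q α u ≤ y}) := by
    constructor
    · intro u hu
      obtain ⟨v, hv, huv⟩ := exists_lt_of_lt_csSup hne hu
      exact (hm huv.le).trans hv
    · intro u hu
      by_contra! hc
      exact absurd (le_csSup hbd (show u ∈ {u | Ph q α u ≤ y} from hc.le)) (not_le.2 hu)
  have i0 := Br_int hα hq0 hq1 hB 0
  have i1 := Br_int hα hq0 hq1 hB 1
  push_cast at i0 i1
  exact ⟨_, i0.1 h0, not_le.1 fun h => absurd (i1.2 h) (not_le.2 h1), hB⟩

noncomputable def gm (q d : ℝ) (y : ℝ) : ℝ := if q * y + d < 1 then q * y + d else q * y + d - 1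

lemma d_bounds (hα : Irrational α) (hα0 : 0 < α) (hα1 : α < 1) (hq0 : 0 < q) (hq1 : q < 1) :
    0 < Ph q α α ∧ Ph q α α < 1 ∧ 1 < q + Ph q α α := by
  have hs := Ph_strictMono hα hq0 hq1
  have e0 := Ph_int α hq0 hq1 0
  have e1 := Ph_int α hq0 hq1 1
  push_cast at e0 e1
  refine ⟨by linarith [hs hα0], by linarith [hs hα1], ?_⟩
  have h := Ph_func α hq0 hq1 (1 - α)
  have hf : ⌊1 - α⌋ = 0 := by
    rw [Int.floor_eq_iff]; push_cast; constructor <;> linarith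
  rw [sub_add_cancel, e1, hf] at h
  have h2 := hs (show 1 - α < 1 by linarith)
  rw [e1] at h2
  push_cast at h
  nlinarith

lemma Br_step (hα : Irrational α) (hα0 : 0 < α) (hα1 : α < 1) (hq0 : 0 < q) (hq1 : q < 1)
    {y x : ℝ} (hy0 : 0 ≤ y) (hy1 : y < 1) (hx0 : 0 ≤ x) (hx1 : x < 1) (h : Br (Ph q α) y x) :
    Br (Ph q α) (gm q (Ph q α α) y) (Int.fract (x + α)) ∧ 0 ≤ gm q (Ph q α α) y ∧
      gm q (Ph q α α) y < 1 ∧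
      gm q (Ph q α α) y - Ph q α (Int.fract (x + α)) = q * (y - Ph q α x) := by
  obtain ⟨d0, d1, d2⟩ := d_bounds hα hα0 hα1 hq0 hq1
  have fx : ⌊x⌋ = 0 := by
    rw [Int.floor_eq_iff]; push_cast; constructor <;> linarith
  have hB : Br (Ph q α) (q * y + Ph q α α) (x + α) := by
    constructor
    · intro u hu
      have e := Ph_func α hq0 hq1 (u - α)
      rw [sub_add_cancel] at e
      have e2 := h.1 (u - α) (by linarith)
      have e3 : ⌊u - α⌋ ≤ 0 := by rw [← fx]; exact Int.floor_mono (by linarith)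
      have e3' : (⌊u - α⌋ : ℝ) ≤ 0 := by exact_mod_cast e3
      nlinarith
    · intro u hu
      have e := Ph_func α hq0 hq1 (u - α)
      rw [sub_add_cancel] at e
      have e2 := h.2 (u - α) (by linarith)
      have e3 : 0 ≤ ⌊u - α⌋ := by rw [← fx]; exact Int.floor_mono (by linarith)
      have e3' : (0 : ℝ) ≤ (⌊u - α⌋ : ℝ) := by exact_mod_cast e3
      nlinarith
  have hi := Br_int hα hq0 hq1 hB 1
  push_cast at hi
  have hf := Ph_func α hq0 hq1 x
  rw [fx] at hf
  push_cast at hf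
  by_cases hc : q * y + Ph q α α < 1
  · have hx : x + α < 1 := by
      by_contra! hh
      linarith [hi.2 hh]
    have hfr : Int.fract (x + α) = x + α := Int.fract_eq_self.2 ⟨by linarith, hx⟩
    have hg : gm q (Ph q α α) y = q * y + Ph q α α := if_pos hc
    rw [hfr, hg]
    refine ⟨hB, by positivity, hc, by linarith⟩
  · have hx : 1 ≤ x + α := hi.1 (not_lt.1 hc)
    have hfr : Int.fract (x + α) = x + α - 1 := by
      rw [Int.fract_eq_iff]
      exact ⟨by linarith, by linarith, 1, by push_cast; ring⟩
    have hg : gm q (Ph q α α) y = q * y + Ph q α α - 1 := if_neg hc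
    have hsh : ∀ u, Ph q α (u + 1) = Ph q α u + 1 := by
      intro u; simpa using Ph_add_int α hq0 hq1 u 1
    rw [hfr, hg]
    push Not at hc
    refine ⟨⟨fun u hu => ?_, fun u hu => ?_⟩, by linarith, by nlinarith, ?_⟩
    · linarith [hsh u, hB.1 (u + 1) (by linarith)]
    · linarith [hsh u, hB.2 (u + 1) (by linarith)]
    · have := hsh (x + α - 1)
      rw [sub_add_cancel] at this
      linarith

lemma Br_iter (hα : Irrational α) (hα0 : 0 < α) (hα1 : α < 1) (hq0 : 0 < q) (hq1 : q < 1)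
    {y x : ℝ} (hy0 : 0 ≤ y) (hy1 : y < 1) (hx0 : 0 ≤ x) (hx1 : x < 1) (h : Br (Ph q α) y x)
    (n : ℕ) :
    Br (Ph q α) ((gm q (Ph q α α))^[n] y) (Int.fract (x + n * α)) ∧
      0 ≤ (gm q (Ph q α α))^[n] y ∧ (gm q (Ph q α α))^[n] y < 1 ∧
      (gm q (Ph q α α))^[n] y - Ph q α (Int.fract (x + n * α)) = q ^ n * (y - Ph q α x) := by
  induction n with
  | zero => simp [Int.fract_eq_self.2 ⟨hx0, hx1⟩, h, hy0, hy1]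
  | succ n ih =>
    obtain ⟨i1, i2, i3, i4⟩ := ih
    have := Br_step hα hα0 hα1 hq0 hq1 i2 i3 (Int.fract_nonneg _) (Int.fract_lt_one _) i1
    have e : Int.fract (Int.fract (x + n * α) + α) = Int.fract (x + ((n + 1 : ℕ) : ℝ) * α) := by
      rw [Int.fract_eq_fract]
      refine ⟨-⌊x + n * α⌋, ?_⟩
      unfold Int.fract
      push_cast
      ring
    rw [e, i4] at this
    rw [Function.iterate_succ_apply']
    refine ⟨this.1, this.2.1, this.2.2.1, ?_⟩
    rw [this.2.2.2]
    ring

lemma Ph_iter (hα : Irrational α) (hα0 : 0 < α) (hα1 : α < 1) (hq0 : 0 < q) (hq1 : q < 1)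
    {x : ℝ} (hx0 : 0 ≤ x) (hx1 : x < 1) (n : ℕ) :
    (gm q (Ph q α α))^[n] (Ph q α x) = Ph q α (Int.fract (x + n * α)) := by
  have hs := Ph_strictMono hα hq0 hq1
  have e0 := Ph_int α hq0 hq1 0
  have e1 := Ph_int α hq0 hq1 1
  push_cast at e0 e1
  have := (Br_iter hα hα0 hα1 hq0 hq1 (y := Ph q α x) (by linarith [hs.monotone hx0])
    (by linarith [hs hx1]) hx0 hx1
    ⟨fun u hu => (hs hu).le, fun u hu => (hs hu).le⟩ n).2.2.2
  rw [sub_self, mul_zero] at this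
  linarith

lemma trap {d : ℝ} (hq0 : 0 < q) (hq1 : q < 1) (d0 : 0 < d) (d1 : d < 1) (d2 : 1 < q + d) (y : ℝ) :
    ∃ M : ℕ, 0 ≤ (gm q d)^[M] y ∧ (gm q d)^[M] y < 1 := by
  have up : ∀ n : ℕ, ∀ y : ℝ, 0 ≤ y → y < 1 + n * (1 - d) →
      ∃ M : ℕ, 0 ≤ (gm q d)^[M] y ∧ (gm q d)^[M] y < 1 := by
    intro n
    induction n with
    | zero => intro y h0 h1; exact ⟨0, by simpa using h0, by simpa using h1⟩
    | succ n ih =>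
      intro y h0 h1
      by_cases hy : y < 1
      · exact ⟨0, h0, hy⟩
      · push Not at hy
        push_cast at h1
        have hg : gm q d y = q * y + d - 1 := if_neg (by nlinarith)
        obtain ⟨M, hM⟩ := ih (gm q d y) (by rw [hg]; nlinarith) (by rw [hg]; nlinarith)
        exact ⟨M + 1, by simpa using hM⟩
  have dn : ∀ n : ℕ, ∀ y : ℝ, y < 1 → -(n * d) ≤ y →
      ∃ M : ℕ, 0 ≤ (gm q d)^[M] y ∧ (gm q d)^[M] y < 1 := by
    intro n
    induction n with
    | zero => intro y h0 h1; exact ⟨0, by simpa using h1, by simpa using h0⟩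
    | succ n ih =>
      intro y h0 h1
      by_cases hy : 0 ≤ y
      · exact ⟨0, hy, h0⟩
      · push Not at hy
        push_cast at h1
        have hg : gm q d y = q * y + d := if_pos (by nlinarith)
        obtain ⟨M, hM⟩ := ih (gm q d y) (by rw [hg]; nlinarith) (by rw [hg]; nlinarith)
        exact ⟨M + 1, by simpa using hM⟩
  by_cases hy : 0 ≤ y
  · obtain ⟨n, hn⟩ := exists_nat_gt (y / (1 - d))
    rw [div_lt_iff₀ (by linarith)] at hn
    exact up n y hy (by linarith)
  · obtain ⟨n, hn⟩ := exists_nat_gt (-y / d)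
    rw [div_lt_iff₀ d0] at hn
    exact dn n y (by linarith) (by linarith)

lemma orbit (hα : Irrational α) (hα0 : 0 < α) (hα1 : α < 1) (hq0 : 0 < q) (hq1 : q < 1) (y : ℝ) :
    ∃ (M : ℕ) (x c : ℝ), ∀ n ≥ M,
      Br (Ph q α) ((gm q (Ph q α α))^[n] y) (Int.fract (x + n * α)) ∧
      (gm q (Ph q α α))^[n] y - Ph q α (Int.fract (x + n * α)) = c * q ^ n := by
  obtain ⟨d0, d1, d2⟩ := d_bounds hα hα0 hα1 hq0 hq1
  obtain ⟨M, h0, h1⟩ := trap hq0 hq1 d0 d1 d2 y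
  obtain ⟨x, x0, x1, hx⟩ := Br_exists hα hq0 hq1 h0 h1
  refine ⟨M, x - M * α, ((gm q (Ph q α α))^[M] y - Ph q α x) / q ^ M, fun n hn => ?_⟩
  obtain ⟨n, rfl⟩ := Nat.exists_eq_add_of_le' hn
  have := Br_iter hα hα0 hα1 hq0 hq1 h0 h1 x0 x1 hx n
  rw [← Function.iterate_add_apply] at this
  have e : x - M * α + ((n + M : ℕ) : ℝ) * α = x + n * α := by push_cast; ring
  rw [e]
  refine ⟨this.1, ?_⟩
  rw [this.2.2.2, pow_add]
  have : q ^ M ≠ 0 := (pow_pos hq0 M).ne'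
  field_simp

end

/-! The abstract argument -/

lemma frac_dense {α : ℝ} (hα : Irrational α) (x : ℝ) {a b : ℝ} (h : a < b) (h0 : 0 ≤ a)
    (h1 : b ≤ 1) (M : ℕ) :
    ∃ n ≥ M, a < Int.fract (x + n * α) ∧ Int.fract (x + n * α) < b := by
  obtain ⟨n, hn, k, h2, h3⟩ := nat_dense hα x h M
  have e : Int.fract (x + n * α) = x + n * α + k := by
    rw [Int.fract_eq_iff]
    exact ⟨by linarith, by linarith, -k, by push_cast; ring⟩
  exact ⟨n, hn, by rw [e]; exact h2, by rw [e]; exact h3⟩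

section
variable {f P : ℝ → ℝ} {α : ℝ}

lemma right_pt (hR : ∀ x, Tendsto P (𝓝[>] x) (𝓝 (P x))) (x : ℝ) {w ε : ℝ}
    (hw : x < w) (hε : 0 < ε) : ∃ v, x < v ∧ v < w ∧ P v < P x + ε := by
  have h1 : ∀ᶠ v in 𝓝[>] x, P v < P x + ε := (hR x).eventually (gt_mem_nhds (by linarith))
  have h2 : ∀ᶠ v in 𝓝[>] x, v ∈ Set.Ioo x w := Ioo_mem_nhdsGT hw
  obtain ⟨v, hv1, hv2⟩ := (h1.and h2).exists
  exact ⟨v, hv2.1, hv2.2, hv1⟩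

lemma cantor (hP : StrictMono P) (hR : ∀ x, Tendsto P (𝓝[>] x) (𝓝 (P x)))
    (hgap : ∀ a b, a < b → ∃ z, a < z ∧ z < b ∧ ∃ γ > 0, ∀ u < z, P u + γ ≤ P z) :
    IsCantorSet (closure (P '' Set.Ico 0 1)) := by
  refine ⟨?_, ?_, ?_, ?_⟩
  · exact ⟨P 0, subset_closure ⟨0, by simp, rfl⟩⟩
  · have : P '' Set.Ico 0 1 ⊆ Set.Icc (P 0) (P 1) := by
      rintro _ ⟨u, hu, rfl⟩
      exact ⟨hP.monotone hu.1, hP.monotone hu.2.le⟩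
    exact isCompact_Icc.of_isClosed_subset isClosed_closure (closure_minimal this isClosed_Icc)
  · apply Preperfect.perfect_closure
    rw [preperfect_iff_nhds]
    rintro _ ⟨x, hx, rfl⟩ U hU
    obtain ⟨ε, hε, hb⟩ := Metric.mem_nhds_iff.1 hU
    obtain ⟨v, h1, h2, h3⟩ := right_pt hR x hx.2 hε
    refine ⟨P v, ⟨hb ?_, v, ⟨by linarith [hx.1], h2⟩, rfl⟩, (hP h1).ne'⟩
    rw [Metric.mem_ball, Real.dist_eq, abs_lt]
    constructor <;> linarith [hP h1]
  · unfold IsNowhereDense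
    rw [closure_closure, Set.eq_empty_iff_forall_notMem]
    intro p hp
    obtain ⟨_, hq, x, hx, rfl⟩ :=
      mem_closure_iff.1 (interior_subset hp) _ isOpen_interior hp
    obtain ⟨ε, hε, hb⟩ := Metric.isOpen_iff.1 isOpen_interior _ hq
    obtain ⟨v, h1, h2, h3⟩ := right_pt hR x hx.2 hε
    obtain ⟨z, z1, z2, γ, hγ, hz⟩ := hgap x v h1
    have hmem : P z - γ / 2 ∈ closure (P '' Set.Ico 0 1) := by
      apply interior_subset
      apply hb
      rw [Metric.mem_ball, Real.dist_eq, abs_lt]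
      constructor <;> linarith [hz x z1, hP z2]
    obtain ⟨_, hw, u, hu, rfl⟩ :=
      mem_closure_iff.1 hmem (Set.Ioo (P z - γ) (P z)) isOpen_Ioo ⟨by linarith, by linarith⟩
    rcases lt_or_ge u z with h | h
    · linarith [hz u h, hw.1]
    · linarith [hP.monotone h, hw.2]

lemma omega_eq (hα : Irrational α) (hP : StrictMono P)
    (hR : ∀ x, Tendsto P (𝓝[>] x) (𝓝 (P x))) (S x : ℝ)
    (hT : Tendsto (fun n : ℕ => f^[n] S - P (Int.fract (x + n * α))) atTop (𝓝 0)) :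
    omegaLim f S = closure (P '' Set.Ico 0 1) := by
  ext p
  constructor
  · rintro ⟨n, hn, hp⟩
    have h := hp.sub (hT.comp hn.tendsto_atTop)
    rw [sub_zero] at h
    refine mem_closure_of_tendsto h (Eventually.of_forall fun k => ?_)
    refine ⟨Int.fract (x + n k * α), ⟨Int.fract_nonneg _, Int.fract_lt_one _⟩, ?_⟩
    simp
  · intro hp
    have hc : MapClusterPt p atTop (fun n => f^[n] S) := by
      rw [Metric.nhds_basis_ball.mapClusterPt_iff_frequently]
      intro ε hε
      rw [frequently_atTop]
      intro M
      obtain ⟨_, ⟨u, hu, rfl⟩, hd⟩ := Metric.mem_closure_iff.1 hp (ε / 3) (by linarith)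
      obtain ⟨v, v1, v2, v3⟩ := right_pt hR u hu.2 (show 0 < ε / 3 by linarith)
      obtain ⟨M', hM'⟩ := Metric.tendsto_atTop.1 hT (ε / 3) (by linarith)
      obtain ⟨n, hn, n1, n2⟩ := frac_dense hα x v1 hu.1 v2.le (max M M')
      refine ⟨n, (le_max_left _ _).trans hn, ?_⟩
      have h1 := hM' n ((le_max_right _ _).trans hn)
      have h2 := hP n1
      have h3 := hP n2
      rw [Real.dist_eq, abs_lt] at hd h1
      rw [Metric.mem_ball, Real.dist_eq, abs_lt]
      constructor <;> linarith [hd.1, hd.2, h1.1, h1.2]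
    obtain ⟨n, hn, h⟩ := hc.tendsto_subseq
    exact ⟨n, hn, h⟩

lemma sens (hα : Irrational α) (hP : StrictMono P)
    (hR : ∀ x, Tendsto P (𝓝[>] x) (𝓝 (P x))) (hP0 : 0 ≤ P 0)
    (hiter : ∀ x, 0 ≤ x → x < 1 → ∀ n : ℕ, f^[n] (P x) = P (Int.fract (x + n * α))) :
    ∃ η : ℝ, 0 < η ∧ ∀ S₀ ∈ closure (P '' Set.Ico 0 1), ∀ ε > 0, ∃ S₀' : ℝ, ∃ k : ℕ,
        0 ≤ S₀' ∧ |S₀' - S₀| ≤ ε ∧ η ≤ |f^[k] S₀' - f^[k] S₀| := by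
  have hh : P (1 / 4) < P (1 / 2) := hP (by norm_num)
  refine ⟨(P (1 / 2) - P (1 / 4)) / 2, by linarith, fun S hS ε hε => ?_⟩
  obtain ⟨_, ⟨u, hu, rfl⟩, hd⟩ := Metric.mem_closure_iff.1 hS (ε / 2) (by linarith)
  obtain ⟨v, v1, v2, v3⟩ := right_pt hR u (show u < min 1 (u + 1 / 4) from
    lt_min hu.2 (by linarith)) (show 0 < ε / 2 by linarith)
  have v4 : v < 1 := v2.trans_le (min_le_left _ _)
  have v5 : v < u + 1 / 4 := v2.trans_le (min_le_right _ _)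
  obtain ⟨k, -, k1, k2⟩ := frac_dense hα v (show (0 : ℝ) < v - u by linarith) le_rfl
    (by linarith [hu.1]) 0
  have e : Int.fract (u + k * α) = 1 + Int.fract (v + k * α) - (v - u) := by
    rw [Int.fract_eq_iff]
    refine ⟨by linarith, by linarith, ⌊v + k * α⌋ - 1, ?_⟩
    unfold Int.fract
    push_cast
    ring
  have fu := hiter u hu.1 hu.2 k
  have fv := hiter v (by linarith [hu.1]) v4 k
  have l1 : P (1 / 2) < P (Int.fract (u + k * α)) := hP (by rw [e]; linarith)
  have l2 : P (Int.fract (v + k * α)) < P (1 / 4) := hP (by linarith)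
  rw [← fu] at l1
  rw [← fv] at l2
  have m1 := hP.monotone hu.1
  have m2 := hP v1
  rw [Real.dist_eq, abs_lt] at hd
  rcases le_or_gt ((P (1 / 2) - P (1 / 4)) / 2) (f^[k] (P u) - f^[k] S) with h | h
  · exact ⟨P u, k, by linarith, by rw [abs_le]; constructor <;> linarith,
      h.trans (le_abs_self _)⟩
  · refine ⟨P v, k, by linarith, by rw [abs_le]; constructor <;> linarith, ?_⟩
    rw [abs_sub_comm]
    refine le_trans ?_ (le_abs_self _)
    linarith

open scoped Classical in
lemma freq_main (hα : Irrational α) (J : Set ℝ) (hJ : J.OrdConnected) :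
    ∃ c : ℝ, 0 ≤ c ∧ ∀ (S x : ℝ) (M : ℕ),
      (∀ n ≥ M, Br P (f^[n] S) (Int.fract (x + n * α))) →
      Tendsto (fun N => (visitCount f S J N : ℝ) / N) atTop (𝓝 c) := by
  obtain ⟨I, hI⟩ : ∃ I : Set ℝ, ∀ x, x ∈ I ↔ (0 ≤ x ∧ x ≤ 1 ∧ ∃ y ∈ J, Br P y x) :=
    ⟨{x | 0 ≤ x ∧ x ≤ 1 ∧ ∃ y ∈ J, Br P y x}, fun _ => Iff.rfl⟩
  have bb : BddBelow I := ⟨0, fun x hx => ((hI x).1 hx).1⟩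
  have ba : BddAbove I := ⟨1, fun x hx => ((hI x).1 hx).2.1⟩
  have h0 : 0 ≤ sInf I := Real.sInf_nonneg fun x hx => ((hI x).1 hx).1
  have h1 : sSup I ≤ 1 := Real.sSup_le (fun x hx => ((hI x).1 hx).2.1) zero_le_one
  have hes : sInf I ≤ sSup I := by
    rcases I.eq_empty_or_nonempty with h | h
    · rw [h]; simp
    · exact csInf_le_csSup h bb ba
  refine ⟨sSup I - sInf I, by linarith, fun S x M hB => ?_⟩
  have hfin := freq_congr (B := fun n => f^[n] S ∈ J) ?_ (freq_rot hα x h0 hes h1)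
  · unfold visitCount
    exact hfin
  filter_upwards [eventually_ge_atTop M, rot_inj hα x (sInf I), rot_inj hα x (sSup I)]
    with n hn n1 n2
  have hb := hB n hn
  constructor
  · rintro ⟨g1, g2⟩
    have g1' := lt_of_le_of_ne g1 n1.symm
    have hne : I.Nonempty := by
      by_contra hc
      rw [Set.not_nonempty_iff_eq_empty] at hc
      rw [hc] at g1 g2
      simp at g1 g2
      linarith
    obtain ⟨a, hIa, a1⟩ := exists_lt_of_csInf_lt hne g1'
    obtain ⟨-, -, ya, hya, ha⟩ := (hI a).1 hIa
    obtain ⟨b, hIb, b1⟩ := exists_lt_of_lt_csSup hne g2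
    obtain ⟨-, -, yb, hyb, hb'⟩ := (hI b).1 hIb
    obtain ⟨w, w1, w2⟩ := exists_between a1
    obtain ⟨w', w3, w4⟩ := exists_between b1
    exact hJ.out hya hyb ⟨(ha.2 w w1).trans (hb.1 w w2), (hb.2 w' w3).trans (hb'.1 w' w4)⟩
  · intro hy
    have hm : Int.fract (x + n * α) ∈ I :=
      (hI _).2 ⟨Int.fract_nonneg _, (Int.fract_lt_one _).le, _, hy, hb⟩
    exact ⟨csInf_le bb hm, lt_of_le_of_ne (le_csSup ba hm) n2⟩

end

/-! The concrete system -/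

lemma irr_alpha : Irrational alphaRot := by
  have h5 : Irrational (Real.sqrt 5) := by
    simpa using Nat.Prime.irrational_sqrt (show Nat.Prime 5 by norm_num)
  have := (h5.intCast_sub 3).div_intCast (m := 2) (by norm_num)
  simpa [alphaRot] using this

lemma alpha_bounds : 0 < alphaRot ∧ alphaRot < 1 := by
  have h1 : Real.sqrt 5 < 3 := by rw [Real.sqrt_lt' (by norm_num)]; norm_num
  have h2 : 1 < Real.sqrt 5 := by rw [Real.lt_sqrt (by norm_num)]; norm_num
  unfold alphaRot
  constructor <;> linarith

lemma fibDelta_eq (b : ℝ) (hb : 1 < b) : fibDelta b = Ph (1 / b) alphaRot alphaRot := by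
  have hq0 : 0 < 1 / b := by positivity
  have hq1 : 1 / b < 1 := by rw [div_lt_one (by linarith)]; exact hb
  obtain ⟨a0, a1⟩ := alpha_bounds
  unfold fibDelta Ph
  rw [(Ph_summable alphaRot hq0 hq1 alphaRot).tsum_eq_zero_add]
  have e0 : Pt alphaRot alphaRot 0 = 1 := by
    have : ⌊-alphaRot⌋ = -1 := by
      rw [Int.floor_eq_iff]; push_cast; constructor <;> linarith
    simp [Pt, this]
  have e1 : ∀ k : ℕ, (1 / b) ^ (k + 1) * Pt alphaRot alphaRot (k + 1)
      = (1 / b) * ((fibWord k : ℝ) * (1 / b) ^ k) := by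
    intro k
    have hphi : phiGolden = 2 - alphaRot := by unfold phiGolden alphaRot; ring
    have f1 : ⌊((k : ℝ) + 1) * phiGolden⌋ = ⌊-((k + 1) * alphaRot)⌋ + 2 * (k + 1) := by
      rw [hphi, ← Int.floor_add_intCast]; congr 1; push_cast; ring
    have f2 : ⌊((k : ℝ) + 2) * phiGolden⌋ = ⌊-((k + 1 + 1) * alphaRot)⌋ + 2 * (k + 2) := by
      rw [hphi, ← Int.floor_add_intCast]; congr 1; push_cast; ring
    unfold Pt fibWord
    rw [f1, f2]
    push_cast
    rw [show alphaRot - (k + 1 + 1) * alphaRot = -((k + 1) * alphaRot) by ring]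
    ring
  simp_rw [e1]
  rw [tsum_mul_left, e0]
  ring

lemma conj (b : ℝ) (hb : 1 < b) (y : ℝ) :
    pwc (1 / b - 1) 1000 500 (rhoParam b) (500 * y + 500 * b / (b - 1) * (2 - fibDelta b))
      = 500 * gm (1 / b) (fibDelta b) y + 500 * b / (b - 1) * (2 - fibDelta b) := by
  have hb1 : b - 1 ≠ 0 := by linarith
  have hb0 : 0 < b := by linarith
  have hc : 500 * y + 500 * b / (b - 1) * (2 - fibDelta b) < rhoParam b ↔
      1 / b * y + fibDelta b < 1 := by
    have e : rhoParam b - (500 * y + 500 * b / (b - 1) * (2 - fibDelta b))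
        = 500 * b * (1 - (1 / b * y + fibDelta b)) := by
      unfold rhoParam; field_simp; ring
    have hp : 0 < 500 * b := by positivity
    constructor
    · intro h
      have : 0 < 500 * b * (1 - (1 / b * y + fibDelta b)) := by linarith
      have := (mul_pos_iff_of_pos_left hp).1 this
      linarith
    · intro h
      have := mul_pos hp (show 0 < 1 - (1 / b * y + fibDelta b) by linarith)
      linarith
  unfold pwc gm
  by_cases h : 1 / b * y + fibDelta b < 1
  · rw [if_pos h, if_pos (hc.2 h)]; field_simp; ring
  · rw [if_neg h, if_neg (fun h' => h (hc.1 h'))]; field_simp; ring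

theorem stmt17 (b : ℝ) (hb : 1 < b) :
    ∃ C : Set ℝ, IsCantorSet C ∧ C ⊆ Set.Ici 0 ∧
      (∀ S₀ : ℝ, 0 ≤ S₀ →
        omegaLim (pwc (1 / b - 1) 1000 500 (rhoParam b)) S₀ = C) ∧
      (∃ η : ℝ, 0 < η ∧ ∀ S₀ ∈ C, ∀ ε > 0, ∃ S₀' : ℝ, ∃ k : ℕ,
        0 ≤ S₀' ∧ |S₀' - S₀| ≤ ε ∧
        η ≤ |(pwc (1 / b - 1) 1000 500 (rhoParam b))^[k] S₀' -
              (pwc (1 / b - 1) 1000 500 (rhoParam b))^[k] S₀|) ∧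
      (∀ J : Set ℝ, J ⊆ Set.Ici 0 → J.OrdConnected →
        ∃ c : ℝ, 0 ≤ c ∧ ∀ S₀ : ℝ, 0 ≤ S₀ →
          Tendsto
            (fun N =>
              (visitCount (pwc (1 / b - 1) 1000 500 (rhoParam b)) S₀ J N : ℝ) / N)
            atTop (𝓝 c)) := by
  have hq0 : 0 < 1 / b := by positivity
  have hq1 : 1 / b < 1 := by rw [div_lt_one (by linarith)]; exact hb
  have hα := irr_alpha
  obtain ⟨a0, a1⟩ := alpha_bounds
  have hd := fibDelta_eq b hb
  obtain ⟨d0, d1, d2⟩ := d_bounds hα a0 a1 hq0 hq1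
  have hcj := conj b hb
  rw [hd] at hcj
  set t : ℝ := 500 * b / (b - 1) * (2 - Ph (1 / b) alphaRot alphaRot) with ht
  have ht0 : 0 ≤ t := by
    have h1 : 0 < b - 1 := by linarith
    have h2 : 0 < 2 - Ph (1 / b) alphaRot alphaRot := by linarith
    positivity
  set f := pwc (1 / b - 1) 1000 500 (rhoParam b) with hf
  set g := gm (1 / b) (Ph (1 / b) alphaRot alphaRot) with hg
  set P : ℝ → ℝ := fun u => 500 * Ph (1 / b) alphaRot u + t with hPdef
  have hit : ∀ (n : ℕ) (y : ℝ), f^[n] (500 * y + t) = 500 * g^[n] y + t := by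
    intro n
    induction n with
    | zero => intro y; rfl
    | succ n ih =>
      intro y
      rw [Function.iterate_succ_apply, Function.iterate_succ_apply, hcj, ih]
  have hs := Ph_strictMono hα hq0 hq1
  have hP : StrictMono P := fun u v h => by
    have := hs h
    simp only [hPdef]; linarith
  have hR : ∀ x, Tendsto P (𝓝[>] x) (𝓝 (P x)) := fun x =>
    ((Ph_right alphaRot hq0 hq1 x).const_mul 500).add_const t
  have hP0 : 0 ≤ P 0 := by simp only [hPdef, Ph_zero]; linarith
  have hgap : ∀ a b, a < b → ∃ z, a < z ∧ z < b ∧ ∃ γ > 0, ∀ u < z, P u + γ ≤ P z := by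
    intro u v huv
    obtain ⟨k, m, h1, h2⟩ := jump_dense hα huv
    refine ⟨_, h1, h2, 500 * ((1 - 1 / b) * (1 / b) ^ k),
      mul_pos (by norm_num) (mul_pos (by linarith) (pow_pos hq0 k)), fun w hw => ?_⟩
    have := Ph_jump alphaRot hq0 hq1 k m hw
    simp only [hPdef]; linarith
  have hiter : ∀ x, 0 ≤ x → x < 1 → ∀ n : ℕ,
      f^[n] (P x) = P (Int.fract (x + n * alphaRot)) := by
    intro x x0 x1 n
    simp only [hPdef]
    rw [hit, Ph_iter hα a0 a1 hq0 hq1 x0 x1]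
  have horb : ∀ S : ℝ, ∃ (M : ℕ) (x : ℝ),
      (∀ n ≥ M, Br P (f^[n] S) (Int.fract (x + n * alphaRot))) ∧
      Tendsto (fun n : ℕ => f^[n] S - P (Int.fract (x + n * alphaRot))) atTop (𝓝 0) := by
    intro S
    obtain ⟨M, x, c, h⟩ := orbit hα a0 a1 hq0 hq1 ((S - t) / 500)
    have hS : ∀ n, f^[n] S = 500 * g^[n] ((S - t) / 500) + t := by
      intro n
      rw [← hit]; congr 1; ring
    refine ⟨M, x, fun n hn => ?_, ?_⟩
    · have := (h n hn).1
      rw [hS]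
      refine ⟨fun u hu => ?_, fun u hu => ?_⟩
      · have := this.1 u hu
        simp only [hPdef]; linarith
      · have := this.2 u hu
        simp only [hPdef]; linarith
    · have hz : Tendsto (fun n : ℕ => 500 * c * (1 / b) ^ n) atTop (𝓝 0) := by
        simpa using (tendsto_pow_atTop_nhds_zero_of_lt_one hq0.le hq1).const_mul (500 * c)
      refine hz.congr' ?_
      filter_upwards [eventually_ge_atTop M] with n hn
      have := (h n hn).2
      rw [hS]
      simp only [hPdef]; linarith
  refine ⟨closure (P '' Set.Ico 0 1), cantor hP hR hgap, ?_, ?_, sens hα hP hR hP0 hiter, ?_⟩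
  · refine closure_minimal ?_ isClosed_Ici
    rintro _ ⟨u, hu, rfl⟩
    exact hP0.trans (hP.monotone hu.1)
  · intro S _
    obtain ⟨M, x, -, h⟩ := horb S
    exact omega_eq hα hP hR S x h
  · intro J _ hJ
    obtain ⟨c, hc, h⟩ := freq_main (f := f) (P := P) hα J hJ
    refine ⟨c, hc, fun S _ => ?_⟩
    obtain ⟨M, x, hB, -⟩ := horb S
    exact h S x M hB
end
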